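/- arXiv:2408.08436 — 2 statements merged into one kernel-verified Lean document; each statement's English description precedes it below -/
import Mathlib

section
/- Let d be an integer with d ≡ 5 (mod 12) such that for every prime p dividing d, every finite field extension L of ℚ_p, and every θ ∈ L satisfying θ^3 + 3θ^2 + 3θ - 9 = 0 and generating L over ℚ_p, the element θ is a square in L. Then the greatest common divisor of the set of degrees [K:ℚ], taken over all finite field extensions K of ℚ for which there exists a nonzero x ∈ K^5 with Q_0(x) = Q_∞(x) = 0, equals 2. (That is, the quartic del Pezzo surface X_d has index exactly 2.) -/
/-- The quadratic form `Q₀ = d(u₀² - 3u₁²) + 6u₂² + 6u₂u₃ - 6u₃u₄`. -/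
def Q0 (d : ℤ) {F : Type*} [Field F] (u : Fin 5 → F) : F :=
  (d : F) * (u 0 ^ 2 - 3 * u 1 ^ 2) + 6 * u 2 ^ 2 + 6 * u 2 * u 3 - 6 * u 3 * u 4

/-- The quadratic form `Q∞ = -2d·u₀u₁ + u₂² - 2u₂u₄ - 3u₃² - u₄²`. -/
def Qinf (d : ℤ) {F : Type*} [Field F] (u : Fin 5 → F) : F :=
  -2 * (d : F) * u 0 * u 1 + u 2 ^ 2 - 2 * u 2 * u 4 - 3 * u 3 ^ 2 - u 4 ^ 2

/-- The set of degrees of closed points on `X_d`: the degrees `[K:ℚ]` of finite field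
extensions `K/ℚ` over which `Q₀` and `Q∞` have a common nonzero zero in `K⁵`. -/
def Degrees (d : ℤ) : Set ℕ :=
  {n | ∃ (K : Type) (_ : Field K) (_ : Algebra ℚ K) (_ : FiniteDimensional ℚ K),
    Module.finrank ℚ K = n ∧ ∃ x : Fin 5 → K, x ≠ 0 ∧ Q0 d x = 0 ∧ Qinf d x = 0}

section

open Polynomial Module NumberField

/-- `c` is a norm from `K(√(β - 1))` to `K`, written out in coordinates. -/
def IsNormValue {K : Type*} [Field K] (β : K) (c : ℚ) : Prop :=
  ∃ x y : K, (c : K) = x ^ 2 - (β - 1) * y ^ 2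

namespace IsNormValue

variable {K : Type*} [Field K] {β : K}

theorem sq (β : K) (c : ℚ) : IsNormValue β (c ^ 2) := ⟨c, 0, by push_cast; ring⟩

theorem mul [CharZero K] {c c' : ℚ} (h : IsNormValue β c) (h' : IsNormValue β c') :
    IsNormValue β (c * c') := by
  obtain ⟨x, y, h⟩ := h
  obtain ⟨x', y', h'⟩ := h'
  refine ⟨x * x' + (β - 1) * y * y', x * y' + y * x', ?_⟩
  push_cast
  rw [h, h']
  ring

theorem of_mul_sq [CharZero K] {c k : ℚ} (hk : k ≠ 0) (h : IsNormValue β (c * k ^ 2)) :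
    IsNormValue β c := by
  have := h.mul (sq β k⁻¹)
  rwa [mul_assoc, ← mul_pow, mul_inv_cancel₀ hk, one_pow, mul_one] at this

end IsNormValue

/-- `c` is, up to sign, a norm from `K(√(β - 1))` to `K`. -/
def IsSignedNormValue {K : Type*} [Field K] (β : K) (c : ℚ) : Prop :=
  IsNormValue β c ∨ IsNormValue β (-c)

namespace IsSignedNormValue

theorem abs_iff {K : Type*} [Field K] {β : K} {c : ℚ} :
    IsSignedNormValue β |c| ↔ IsSignedNormValue β c := by
  rcases abs_choice c with h | h <;> rw [h]
  simp only [IsSignedNormValue, neg_neg]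
  exact or_comm

variable {K : Type*} [Field K] [CharZero K] {β : K}

theorem mul {c c' : ℚ} (h : IsSignedNormValue β c) (h' : IsSignedNormValue β c') :
    IsSignedNormValue β (c * c') := by
  rcases h with h | h <;> rcases h' with h' | h'
  · exact .inl (h.mul h')
  · exact .inr (by simpa using h.mul h')
  · exact .inr (by simpa using h.mul h')
  · exact .inl (by simpa using h.mul h')

theorem of_mul_sq {c k : ℚ} (hk : k ≠ 0) (h : IsSignedNormValue β (c * k ^ 2)) :
    IsSignedNormValue β c := by
  rcases h with h | h
  · exact .inl (h.of_mul_sq hk)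
  · exact .inr (.of_mul_sq hk (by simpa using h))

theorem of_mul_left {c c' : ℚ} (hc : c ≠ 0) (h : IsSignedNormValue β c)
    (h' : IsSignedNormValue β (c * c')) : IsSignedNormValue β c' :=
  of_mul_sq hc (by convert h.mul h' using 1; ring)

end IsSignedNormValue

/-- The norm form of `ℚ[X]/(X⁴ + 6X² - 24X - 3)` in the basis of powers of the root. -/
def quarticNorm {R : Type*} [CommRing R] (a b c e : R) : R :=
  a^4 - 12*a^3*c + 72*a^3*e + 6*a^2*b^2 - 72*a^2*b*c - 84*a^2*b*e + 30*a^2*c^2 - 144*a^2*c*e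
    + 1998*a^2*e^2 + 24*a*b^3 + 12*a*b^2*c - 288*a*b^2*e + 144*a*b*c^2 - 1800*a*b*c*e
    + 504*a*b*e^2 + 612*a*c^3 + 72*a*c^2*e + 3708*a*c*e^2 + 15120*a*e^3 - 3*b^4 + 36*b^3*e
    - 18*b^2*c^2 + 216*b^2*c*e - 90*b^2*e^2 - 72*b*c^3 - 36*b*c^2*e - 432*b*c*e^2 - 1836*b*e^3
    + 9*c^4 + 54*c^2*e^2 + 216*c*e^3 - 27*e^4

theorem isNormValue_quarticNorm {K : Type*} [Field K] [CharZero K] {β : K} (hβ : β ^ 3 = 10)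
    (a b c e : ℚ) : IsNormValue β (quarticNorm a b c e) := by
  refine ⟨a^2 - 6*a*c + 36*a*e + 2*b^2*β + b^2 - 12*b*c - 8*b*e*β^2 - 20*b*e*β - 14*b*e
      + 8*c^2*β^2 + 8*c^2*β + 5*c^2 - 48*c*e*β - 24*c*e + 48*e^2*β^2 + 42*e^2*β + 333*e^2,
    2*a*b + (4/3)*a*c*β^2 + (4/3)*a*c*β + (4/3)*a*c - 4*a*e*β - 14*a*e + (-2/3)*b^2*β^2
      + (-2/3)*b^2*β + (-2/3)*b^2 + 4*b*c*β + 2*b*c + 8*b*e*β^2 + 8*b*e*β + 32*b*e - 4*c^2*β^2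
      - 4*c^2*β - 28*c^2 + 16*c*e*β^2 + 16*c*e*β + 10*c*e - 26*e^2*β^2 - 122*e^2*β - 218*e^2, ?_⟩
  simp only [quarticNorm]
  push_cast
  linear_combination (-((-16/3)*a^2*b*c + (-16/9)*a^2*c^2*β^2 + (-16/9)*a^2*c^2*β + (-16/9)*a^2*c^2 +
    (32/3)*a^2*c*e*β + (112/3)*a^2*c*e - 16*a^2*e^2 + (8/3)*a*b^3 + (16/9)*a*b^2*c*β^2 +
    (16/9)*a*b^2*c*β + (16/9)*a*b^2*c + (-16/3)*a*b^2*e*β + (-152/3)*a*b^2*e + (-32/3)*a*b*c^2*β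
    + (32/3)*a*b*c^2 + (-64/3)*a*b*c*e*β^2 + (-64/3)*a*b*c*e*β + (-352/3)*a*b*c*e + 64*a*b*e^2*β
    + 328*a*b*e^2 + (32/3)*a*c^3*β^2 + (32/3)*a*c^3*β + (224/3)*a*c^3 + (-128/3)*a*c^2*e*β^2 +
    (-224/3)*a*c^2*e*β + (-416/3)*a*c^2*e + (208/3)*a*c*e^2*β^2 + (1360/3)*a*c*e^2*β +
    (3088/3)*a*c*e^2 - 208*a*e^3*β - 1496*a*e^3 + (-4/9)*b^4*β^2 + (-4/9)*b^4*β + (-4/9)*b^4 +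
    (16/3)*b^3*c*β + (8/3)*b^3*c + (32/3)*b^3*e*β^2 + (32/3)*b^3*e*β + (32/3)*b^3*e +
    (-16/3)*b^2*c^2*β^2 + (-16/3)*b^2*c^2*β + (-64/3)*b^2*c^2 + (64/3)*b^2*c*e*β^2 +
    (-128/3)*b^2*c*e*β + (-56/3)*b^2*c*e + (-296/3)*b^2*e^2*β^2 + (-488/3)*b^2*e^2*β +
    (-680/3)*b^2*e^2 + 32*b*c^3*β + 16*b*c^3 + 64*b*c^2*e*β^2 - 192*b*c^2*e*β + 128*b*c^2*e -
    256*b*c*e^2*β^2 - 48*b*c*e^2*β + 712*b*c*e^2 + 416*b*e^3*β^2 + 1184*b*e^3*β + 2144*b*e^3 -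
    16*c^4*β^2 + 48*c^4*β - 80*c^4 + 128*c^3*e*β^2 + 128*c^3*e*β + 80*c^3*e - 464*c^2*e^2*β^2 -
    464*c^2*e^2*β - 1616*c^2*e^2 + 832*c*e^3*β^2 + 3904*c*e^3*β + 2056*c*e^3 - 676*e^4*β^2 -
    3364*e^4*β - 15844*e^4)) * hβ

section Quartic

variable {M : Type*} [Field M] [Algebra ℚ M] {x : M} {b : Basis (Fin 4) ℚ M}

theorem quartic_leftMulMatrix (hx : x ^ 4 + 6 * x ^ 2 - 24 * x - 3 = 0)
    (hb : ∀ i, b i = x ^ (i : ℕ)) (a₀ a₁ a₂ a₃ : ℚ) :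
    Algebra.leftMulMatrix b (algebraMap ℚ M a₀ + algebraMap ℚ M a₁ * x + algebraMap ℚ M a₂ * x ^ 2
        + algebraMap ℚ M a₃ * x ^ 3) =
      !![a₀, 3 * a₃, 3 * a₂, 3 * a₁ - 18 * a₃;
        a₁, a₀ + 24 * a₃, 24 * a₂ + 3 * a₃, 24 * a₁ + 3 * a₂ - 144 * a₃;
        a₂, a₁ - 6 * a₃, a₀ - 6 * a₂ + 24 * a₃, -6 * a₁ + 24 * a₂ + 39 * a₃;
        a₃, a₂, a₁ - 6 * a₃, a₀ - 6 * a₂ + 24 * a₃] := by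
  have key : ∀ c₀ c₁ c₂ c₃ : ℚ, ∀ i, b.repr (algebraMap ℚ M c₀ + algebraMap ℚ M c₁ * x
      + algebraMap ℚ M c₂ * x ^ 2 + algebraMap ℚ M c₃ * x ^ 3) i = ![c₀, c₁, c₂, c₃] i := by
    intro c₀ c₁ c₂ c₃ i
    have h : algebraMap ℚ M c₀ + algebraMap ℚ M c₁ * x + algebraMap ℚ M c₂ * x ^ 2
        + algebraMap ℚ M c₃ * x ^ 3 = ∑ j, ![c₀, c₁, c₂, c₃] j • b j := by
      simp [Fin.sum_univ_four, hb, Algebra.smul_def]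
    rw [h, Basis.repr_sum_self]
  ext i j
  rw [Algebra.leftMulMatrix_eq_repr_mul, hb]
  have hcol : ∀ c₀ c₁ c₂ c₃ : ℚ, (algebraMap ℚ M a₀ + algebraMap ℚ M a₁ * x
      + algebraMap ℚ M a₂ * x ^ 2 + algebraMap ℚ M a₃ * x ^ 3) * x ^ (j : ℕ) =
      algebraMap ℚ M c₀ + algebraMap ℚ M c₁ * x + algebraMap ℚ M c₂ * x ^ 2
        + algebraMap ℚ M c₃ * x ^ 3 → b.repr ((algebraMap ℚ M a₀ + algebraMap ℚ M a₁ * x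
      + algebraMap ℚ M a₂ * x ^ 2 + algebraMap ℚ M a₃ * x ^ 3) * x ^ (j : ℕ)) i =
        ![c₀, c₁, c₂, c₃] i := fun c₀ c₁ c₂ c₃ h ↦ by rw [h, key]
  fin_cases j
  · rw [hcol a₀ a₁ a₂ a₃ (by simp)]
    fin_cases i <;> rfl
  · rw [hcol (3 * a₃) (a₀ + 24 * a₃) (a₁ - 6 * a₃) a₂]
    · fin_cases i <;> rfl
    · simp only [map_add, map_sub, map_mul, map_ofNat]
      linear_combination algebraMap ℚ M a₃ * hx
  · rw [hcol (3 * a₂) (24 * a₂ + 3 * a₃) (a₀ - 6 * a₂ + 24 * a₃) (a₁ - 6 * a₃)]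
    · fin_cases i <;> rfl
    · simp only [map_add, map_sub, map_mul, map_ofNat]
      linear_combination (algebraMap ℚ M a₂ + algebraMap ℚ M a₃ * x) * hx
  · rw [hcol (3 * a₁ - 18 * a₃) (24 * a₁ + 3 * a₂ - 144 * a₃) (-6 * a₁ + 24 * a₂ + 39 * a₃)
      (a₀ - 6 * a₂ + 24 * a₃)]
    · fin_cases i <;> rfl
    · simp only [map_add, map_sub, map_mul, map_ofNat, map_neg]
      linear_combination (algebraMap ℚ M a₁ + algebraMap ℚ M a₂ * x
        + algebraMap ℚ M a₃ * (x ^ 2 - 6)) * hx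

theorem quartic_norm (hx : x ^ 4 + 6 * x ^ 2 - 24 * x - 3 = 0)
    (hb : ∀ i, b i = x ^ (i : ℕ)) (a₀ a₁ a₂ a₃ : ℚ) :
    Algebra.norm ℚ (algebraMap ℚ M a₀ + algebraMap ℚ M a₁ * x + algebraMap ℚ M a₂ * x ^ 2
        + algebraMap ℚ M a₃ * x ^ 3) = quarticNorm a₀ a₁ a₂ a₃ := by
  rw [Algebra.norm_eq_matrix_det b, quartic_leftMulMatrix hx hb, Matrix.det_succ_row_zero]
  simp [Fin.sum_univ_succ, Matrix.det_fin_three, Fin.succAbove, Matrix.submatrix, quarticNorm]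
  ring

theorem quartic_trace (hx : x ^ 4 + 6 * x ^ 2 - 24 * x - 3 = 0)
    (hb : ∀ i, b i = x ^ (i : ℕ)) (a₀ a₁ a₂ a₃ : ℚ) :
    Algebra.trace ℚ M (algebraMap ℚ M a₀ + algebraMap ℚ M a₁ * x + algebraMap ℚ M a₂ * x ^ 2
        + algebraMap ℚ M a₃ * x ^ 3) = 4 * a₀ - 12 * a₂ + 72 * a₃ := by
  rw [Algebra.trace_eq_matrix_trace b, quartic_leftMulMatrix hx hb]
  simp [Matrix.trace, Fin.sum_univ_four]
  ring

theorem isNormValue_norm {K : Type*} [Field K] [CharZero K] {β : K} (hβ : β ^ 3 = 10)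
    (hx : x ^ 4 + 6 * x ^ 2 - 24 * x - 3 = 0) (hb : ∀ i, b i = x ^ (i : ℕ)) (α : M) :
    IsNormValue β (Algebra.norm ℚ α) := by
  have h : α = algebraMap ℚ M (b.repr α 0) + algebraMap ℚ M (b.repr α 1) * x
      + algebraMap ℚ M (b.repr α 2) * x ^ 2 + algebraMap ℚ M (b.repr α 3) * x ^ 3 := by
    conv_lhs => rw [← b.sum_repr α]
    simp [Fin.sum_univ_four, hb, Algebra.smul_def]
  rw [h, quartic_norm hx hb]
  exact isNormValue_quarticNorm hβ ..

theorem quartic_discr (hx : x ^ 4 + 6 * x ^ 2 - 24 * x - 3 = 0) (hb : ∀ i, b i = x ^ (i : ℕ)) :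
    Algebra.discr ℚ b = -11059200 := by
  have tr : ∀ n : ℕ, ∀ a₀ a₁ a₂ a₃ : ℚ, x ^ n = algebraMap ℚ M a₀ + algebraMap ℚ M a₁ * x
      + algebraMap ℚ M a₂ * x ^ 2 + algebraMap ℚ M a₃ * x ^ 3 →
      Algebra.trace ℚ M (x ^ n) = 4 * a₀ - 12 * a₂ + 72 * a₃ := fun n a₀ a₁ a₂ a₃ h ↦ by
    rw [h, quartic_trace hx hb]
  have t0 := tr 0 1 0 0 0 (by simp)
  have t1 := tr 1 0 1 0 0 (by simp)
  have t2 := tr 2 0 0 1 0 (by simp)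
  have t3 := tr 3 0 0 0 1 (by simp)
  have t4 := tr 4 3 24 (-6) 0 (by simp; linear_combination hx)
  have t5 := tr 5 0 3 24 (-6) (by simp; linear_combination x * hx)
  have t6 := tr 6 (-18) (-144) 39 24 (by simp; linear_combination (x ^ 2 - 6) * hx)
  simp only [pow_zero, pow_one] at t0 t1
  have : Algebra.traceMatrix ℚ b = !![4, 0, -12, 72; 0, -12, 72, 84; -12, 72, 84, -720;
      72, 84, -720, 1188] := by
    ext i j
    rw [Algebra.traceMatrix_apply, Algebra.traceForm_apply, hb, hb, ← pow_add]
    fin_cases i <;> fin_cases j <;> simp [t0, t1, t2, t3, t4, t5, t6] <;>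
      norm_num
  rw [Algebra.discr_def, this, Matrix.det_succ_row_zero]
  simp [Fin.sum_univ_succ, Matrix.det_fin_three, Fin.succAbove, Matrix.submatrix]
  norm_num

end Quartic

section Quartic

variable {M : Type*} [Field M] [NumberField M] {x : M} {b : Basis (Fin 4) ℚ M}

theorem abs_discr_le (hx : x ^ 4 + 6 * x ^ 2 - 24 * x - 3 = 0) (hb : ∀ i, b i = x ^ (i : ℕ)) :
    |discr M| ≤ 172800 := by
  have h1 : IsIntegral ℤ x := ⟨X ^ 4 + (6 * X ^ 2 - 24 * X - 3), by monicity!, by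
    simp; linear_combination hx⟩
  have h2 : IsIntegral ℤ ((x ^ 2 + 3) / 2) := by
    refine IsIntegral.of_pow (n := 2) two_pos ?_
    have : ((x ^ 2 + 3) / 2) ^ 2 = 3 + 6 * x := by linear_combination hx / 4
    rw [this]
    have h := (isIntegral_algebraMap (R := ℤ) (A := M) (x := 3)).add
      ((isIntegral_algebraMap (R := ℤ) (A := M) (x := 6)).mul h1)
    simpa using h
  have h3 : IsIntegral ℤ ((1 + x) * (x ^ 2 + 5) / 4) := by
    refine ⟨X ^ 4 + (-20 * X ^ 3 + 144 * X ^ 2 - 428 * X + 322), by monicity!, ?_⟩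
    simp
    linear_combination ((2101/256) + (-97/64)*x^1 + (35/64)*x^2 + (-73/64)*x^3 + (5/128)*x^4
      + (1/64)*x^5 + (5/64)*x^6 + (1/64)*x^7 + (1/256)*x^8) * hx
  let w : Fin 4 → 𝓞 M := ![1, ⟨x, h1⟩, ⟨_, h2⟩, ⟨_, h3⟩]
  let v : Fin 4 → M := fun i ↦ w i
  let Q : Matrix (Fin 4) (Fin 4) ℚ :=
    !![1, 0, 3 / 2, 5 / 4; 0, 1, 0, 5 / 4; 0, 0, 1 / 2, 1 / 4; 0, 0, 0, 1 / 4]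
  have hQ : v = Matrix.vecMul b (Q.map (algebraMap ℚ M)) := by
    funext i
    have e0 : ((w 0 : 𝓞 M) : M) = 1 := rfl
    have e1 : ((w 1 : 𝓞 M) : M) = x := rfl
    have e2 : ((w 2 : 𝓞 M) : M) = (x ^ 2 + 3) / 2 := rfl
    have e3 : ((w 3 : 𝓞 M) : M) = (1 + x) * (x ^ 2 + 5) / 4 := rfl
    fin_cases i <;>
      simp [v, e0, e1, e2, e3, Q, Matrix.vecMul, dotProduct, Fin.sum_univ_four, hb, map_div₀,
        map_ofNat, map_inv₀, -eq_ratCast]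
    all_goals ring
  have hdet : Q.det = 1 / 8 := by
    rw [Matrix.det_of_isUpperTriangular]
    · simp [Q, Fin.prod_univ_four]; norm_num
    · intro i j hij
      fin_cases i <;> fin_cases j <;> first | rfl | (exact absurd hij (by decide))
  have hv : Algebra.discr ℚ v = -172800 := by
    rw [hQ, Algebra.discr_of_matrix_vecMul, hdet, quartic_discr hx hb]
    norm_num
  have hcard : Fintype.card (Free.ChooseBasisIndex ℤ (𝓞 M)) = Fintype.card (Fin 4) := by
    rw [← finrank_eq_card_basis (integralBasis M), ← finrank_eq_card_basis b]
  let e := Fintype.equivOfCardEq hcard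
  let ω := (integralBasis M).reindex e
  have hω : Algebra.discr ℚ ω = discr M := by
    rw [coe_discr, ← Algebra.discr_reindex ℚ (integralBasis M) e, Basis.coe_reindex]
  let P : Matrix (Fin 4) (Fin 4) ℤ := fun i j ↦ (RingOfIntegers.basis M).repr (w j) (e.symm i)
  have hP : v = Matrix.vecMul ω ((P.map (algebraMap ℤ ℚ)).map (algebraMap ℚ M)) := by
    funext j
    rw [← ω.sum_repr (v j)]
    simp only [Matrix.vecMul, dotProduct]
    refine Finset.sum_congr rfl fun i _ ↦ ?_
    have : ω.repr (v j) i = algebraMap ℤ ℚ (P i j) := by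
      simp only [ω, Basis.repr_reindex_apply, v, P]
      exact integralBasis_repr_apply M (w j) _
    rw [this, Algebra.smul_def, mul_comm]
    rfl
  have hfin : P.det ^ 2 * discr M = -172800 := by
    have := Algebra.discr_of_matrix_vecMul ω (P.map (algebraMap ℤ ℚ))
    rw [← hP, hv, hω, ← RingHom.mapMatrix_apply, ← RingHom.map_det] at this
    have h : ((P.det ^ 2 * discr M : ℤ) : ℚ) = ((-172800 : ℤ) : ℚ) := by
      rw [Int.cast_mul, Int.cast_pow, Int.cast_neg, Int.cast_ofNat, this, eq_intCast]
    exact_mod_cast h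
  refine Int.le_of_dvd (by norm_num) ?_
  rw [abs_dvd]
  exact (Int.dvd_neg).1 ⟨P.det ^ 2, by rw [← hfin]; ring⟩

theorem exists_absNorm_le (hx : x ^ 4 + 6 * x ^ 2 - 24 * x - 3 = 0)
    (hb : ∀ i, b i = x ^ (i : ℕ)) (C : ClassGroup (𝓞 M)) :
    ∃ I, ClassGroup.mk0 I = C ∧ Ideal.absNorm (I : Ideal (𝓞 M)) ≤ 63 := by
  obtain ⟨I, hI, hle⟩ := exists_ideal_in_class_of_norm_le C
  refine ⟨I, hI, Nat.lt_succ_iff.1 ?_⟩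
  have hfr : finrank ℚ M = 4 := by simpa using finrank_eq_card_basis b
  have hc : InfinitePlace.nrComplexPlaces M ≤ 2 := by
    have := InfinitePlace.card_add_two_mul_card_eq_rank M
    omega
  have hd : √|(discr M : ℝ)| ≤ 415.7 := by
    rw [Real.sqrt_le_left (by norm_num)]
    have : ((|discr M| : ℤ) : ℝ) ≤ (172800 : ℤ) := by exact_mod_cast abs_discr_le hx hb
    push_cast at this
    linarith
  have hpi : 4 / Real.pi ≤ 1.2733 := by
    rw [div_le_iff₀ Real.pi_pos]
    nlinarith [Real.pi_gt_d4]
  have hpi' : 1 ≤ 4 / Real.pi := by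
    rw [le_div_iff₀ Real.pi_pos]
    nlinarith [Real.pi_lt_d4]
  have : (4 / Real.pi) ^ InfinitePlace.nrComplexPlaces M ≤ 1.2733 ^ 2 :=
    (pow_le_pow_right₀ hpi' hc).trans (pow_le_pow_left₀ (by linarith) hpi 2)
  rw [hfr] at hle
  have h4 : ((Nat.factorial 4 : ℕ) : ℝ) / ((4 : ℕ) : ℝ) ^ 4 = 3 / 32 := by
    norm_num [Nat.factorial]
  rw [h4] at hle
  have : (Ideal.absNorm (I : Ideal (𝓞 M)) : ℝ) < (64 : ℕ) := by
    refine hle.trans_lt ((mul_le_mul this (mul_le_mul_of_nonneg_left hd (by norm_num))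
      (by positivity) (by positivity)).trans_lt ?_)
    norm_num
  exact_mod_cast this

end Quartic

theorem isSignedNormValue_of_quarticNorm_eq {K : Type*} [Field K] [CharZero K] {β : K}
    (hβ : β ^ 3 = 10) {p : ℚ} (a b c e k : ℚ) (hk : k ≠ 0)
    (h : |quarticNorm a b c e| = p * k ^ 2) : IsSignedNormValue β p :=
  .of_mul_sq hk (h ▸ IsSignedNormValue.abs_iff.2 (.inl (isNormValue_quarticNorm hβ a b c e)))

theorem isSignedNormValue_of_prime_le {K : Type*} [Field K] [CharZero K] {β : K}
    (hβ : β ^ 3 = 10) {p : ℕ} (hp : p.Prime) (hp' : p ≤ 63)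
    (h : p ≤ 5 ∨ ∃ r : ZMod p, r ^ 4 + 6 * r ^ 2 - 24 * r - 3 = 0) : IsSignedNormValue β p := by
  have key := fun a b c e k ↦ isSignedNormValue_of_quarticNorm_eq hβ (p := p) a b c e k
  simp only [quarticNorm] at key
  interval_cases p <;> first
    | exact absurd hp (by decide)
    | exact absurd h (by simp only [not_or]; decide)
    | skip
  · exact key (-3) 0 1 0 24 (by norm_num) (by norm_num)
  · exact key 0 (-1) 0 0 1 (by norm_num) (by norm_num)
  · exact key (-1) 1 0 0 2 (by norm_num) (by norm_num)
  · exact key (-1) (-1) 0 0 2 (by norm_num) (by norm_num)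
  · exact key (-2) 1 0 0 1 (by norm_num) (by norm_num)
  · exact key (-3) 0 (-1) 0 12 (by norm_num) (by norm_num)
  · exact key (-2) 1 1 0 10 (by norm_num) (by norm_num)
  · exact key (-3) (-3) (-2) 0 30 (by norm_num) (by norm_num)
  · exact key (-1) 2 1 0 8 (by norm_num) (by norm_num)
  · exact key (-3) (-3) 2 0 6 (by norm_num) (by norm_num)
  · exact key (-4) 1 (-1) 0 10 (by norm_num) (by norm_num)
  · exact key (-1) 3 (-2) 0 10 (by norm_num) (by norm_num)
  · exact key (-1) (-4) 1 0 4 (by norm_num) (by norm_num)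

theorem map_quartic {R S : Type*} [CommRing R] [CommRing S] (φ : R →+* S) (y : R) :
    φ (y ^ 4 + 6 * y ^ 2 - 24 * y - 3) = φ y ^ 4 + 6 * φ y ^ 2 - 24 * φ y - 3 := by
  simp [map_ofNat]

section Quartic

variable {M : Type*} [Field M] [NumberField M]

theorem exists_absNorm_eq_pow (P : Ideal (𝓞 M)) (hP : P.IsPrime) (hP0 : P ≠ ⊥) :
    ∃ p n : ℕ, p.Prime ∧ n ≠ 0 ∧ Ideal.absNorm P = p ^ n ∧
      (n = 1 → Nonempty ((𝓞 M) →+* ZMod p)) := by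
  have := hP.isMaximal hP0
  let := Ideal.Quotient.field P
  have hcard : Ideal.absNorm P = Nat.card (𝓞 M ⧸ P) := by
    rw [Ideal.absNorm_apply, Submodule.cardQuot_apply]
  have : Finite (𝓞 M ⧸ P) := Ideal.finiteQuotientOfFreeOfNeBot P hP0
  have := Fintype.ofFinite (𝓞 M ⧸ P)
  obtain ⟨p, _, n, hp, hpn⟩ := FiniteField.card' (𝓞 M ⧸ P)
  refine ⟨p, n, hp, n.ne_zero, by rw [hcard, Nat.card_eq_fintype_card, hpn], fun hn ↦ ?_⟩
  have := Fact.mk hp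
  rw [hn, pow_one] at hpn
  exact ⟨((ZMod.ringEquivOfPrime (𝓞 M ⧸ P) hp (by rw [hpn])).symm : _ →+* ZMod p).comp
    (Ideal.Quotient.mk P)⟩

variable {x : M} {b : Basis (Fin 4) ℚ M} {K : Type*} [Field K] [CharZero K] {β : K}

theorem isSignedNormValue_of_isPrime (hβ : β ^ 3 = 10) (hx : x ^ 4 + 6 * x ^ 2 - 24 * x - 3 = 0)
    (P : Ideal (𝓞 M)) (hP : P.IsPrime) (hP0 : P ≠ ⊥) (hle : Ideal.absNorm P ≤ 63) :
    IsSignedNormValue β (Ideal.absNorm P) := by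
  obtain ⟨p, n, hp, hn, heq, hhom⟩ := exists_absNorm_eq_pow P hP hP0
  rw [heq] at hle ⊢
  have hple : p ≤ 63 := (Nat.le_self_pow hn p).trans hle
  rcases Nat.even_or_odd' n with ⟨k, rfl | rfl⟩
  · exact .inl (by convert IsNormValue.sq β ((p : ℚ) ^ k) using 1; push_cast; ring)
  · suffices h : IsSignedNormValue β p by
      convert h.mul (.inl (IsNormValue.sq β ((p : ℚ) ^ k))) using 1; push_cast; ring
    refine isSignedNormValue_of_prime_le hβ hp hple ?_
    rcases Nat.eq_zero_or_pos k with rfl | hk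
    · obtain ⟨φ⟩ := hhom rfl
      have h1 : IsIntegral ℤ x := ⟨X ^ 4 + (6 * X ^ 2 - 24 * X - 3), by monicity!, by
        simp; linear_combination hx⟩
      let x' : 𝓞 M := ⟨x, h1⟩
      have hx' : x' ^ 4 + 6 * x' ^ 2 - 24 * x' - 3 = 0 := by
        apply RingOfIntegers.coe_injective
        rw [map_quartic, map_zero]
        exact hx
      exact .inr ⟨φ x', by rw [← map_quartic, hx', map_zero]⟩
    · left
      by_contra! h
      have h1 : p ^ 3 ≤ p ^ (2 * k + 1) := Nat.pow_le_pow_right hp.pos (by omega)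
      have h2 : 6 ^ 3 ≤ p ^ 3 := Nat.pow_le_pow_left h 3
      omega

theorem isSignedNormValue_absNorm (hβ : β ^ 3 = 10)
    (hx : x ^ 4 + 6 * x ^ 2 - 24 * x - 3 = 0) (hb : ∀ i, b i = x ^ (i : ℕ))
    (I : Ideal (𝓞 M)) (hI : I ≠ ⊥) : IsSignedNormValue β (Ideal.absNorm I) := by
  have hsmall : ∀ J : Ideal (𝓞 M), J ≠ 0 → Ideal.absNorm J ≤ 63 →
      IsSignedNormValue β (Ideal.absNorm J) := by
    intro J
    induction J using UniqueFactorizationMonoid.induction_on_prime with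
    | h₁ => exact fun h ↦ absurd rfl h
    | h₂ J hJ =>
      intro _ _
      rw [Ideal.isUnit_iff] at hJ
      simpa [hJ] using (show IsSignedNormValue β _ from .inl (IsNormValue.sq β 1))
    | h₃ J P hJ hP ih =>
      intro _ hle
      rw [map_mul] at hle ⊢
      have h1 : 0 < Ideal.absNorm J := Nat.pos_of_ne_zero (by rwa [Ne, Ideal.absNorm_eq_zero_iff])
      have h2 : 0 < Ideal.absNorm P :=
        Nat.pos_of_ne_zero (by rw [Ne, Ideal.absNorm_eq_zero_iff]; exact hP.ne_zero)
      push_cast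
      exact (isSignedNormValue_of_isPrime hβ hx P (Ideal.isPrime_of_prime hP) hP.ne_zero
        (by nlinarith)).mul (ih hJ (by nlinarith))
  have hspan : ∀ a : 𝓞 M, IsSignedNormValue β (Ideal.absNorm (Ideal.span {a})) := by
    intro a
    rw [Ideal.absNorm_span_singleton, Nat.cast_natAbs, Int.cast_abs, IsSignedNormValue.abs_iff,
      Algebra.coe_norm_int]
    exact .inl (isNormValue_norm hβ hx hb _)
  obtain ⟨J, hJ, hle⟩ := exists_absNorm_le hx hb
    (ClassGroup.mk0 ⟨I, mem_nonZeroDivisors_iff_ne_zero.2 hI⟩)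
  obtain ⟨a, c, ha, -, h⟩ := ClassGroup.mk0_eq_mk0_iff.1 hJ.symm
  have h := congrArg Ideal.absNorm h
  rw [map_mul, map_mul] at h
  have h' := (hspan c).mul (hsmall J (mem_nonZeroDivisors_iff_ne_zero.1 J.2) hle)
  rw [← Nat.cast_mul, ← h, Nat.cast_mul] at h'
  refine .of_mul_left ?_ (hspan a) h'
  simpa [Ideal.absNorm_eq_zero_iff] using ha

theorem isSignedNormValue_of_dvd_absNorm (hβ : β ^ 3 = 10)
    (hx : x ^ 4 + 6 * x ^ 2 - 24 * x - 3 = 0) (hb : ∀ i, b i = x ^ (i : ℕ)) {p : ℕ}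
    (hp : p.Prime) (J : Ideal (𝓞 M)) (hJ : p ∣ Ideal.absNorm J) (hJ' : ¬ p ^ 2 ∣ Ideal.absNorm J) :
    IsSignedNormValue β p := by
  induction J using UniqueFactorizationMonoid.induction_on_prime with
  | h₁ => simp at hJ'
  | h₂ J hu =>
    rw [Ideal.isUnit_iff] at hu
    simp [hu, hp.ne_one] at hJ
  | h₃ J P _ hP ih =>
    rw [map_mul] at hJ hJ'
    rcases hp.dvd_mul.1 hJ with h | h
    · have h' : ¬ p ^ 2 ∣ Ideal.absNorm P := fun h ↦ hJ' (h.mul_right _)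
      have hs := isSignedNormValue_absNorm hβ hx hb P hP.ne_zero
      obtain ⟨q, n, hq, hn, heq, -⟩ := exists_absNorm_eq_pow P (Ideal.isPrime_of_prime hP) hP.ne_zero
      rw [heq] at h h' hs
      obtain rfl := (Nat.prime_dvd_prime_iff_eq hp hq).1 (hp.dvd_of_dvd_pow h)
      have : n = 1 := by
        by_contra hn1
        exact h' (pow_dvd_pow _ (by omega))
      simpa [this] using hs
    · exact ih h fun h ↦ hJ' (h.mul_left _)

theorem isSignedNormValue_of_root (hβ : β ^ 3 = 10)
    (hx : x ^ 4 + 6 * x ^ 2 - 24 * x - 3 = 0) (hb : ∀ i, b i = x ^ (i : ℕ)) {p : ℕ}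
    (hp : p.Prime) (hp30 : ¬ p ∣ 30) (h : ∃ r : ZMod p, r ^ 4 + 6 * r ^ 2 - 24 * r - 3 = 0) :
    IsSignedNormValue β p := by
  have h1 : IsIntegral ℤ x := ⟨X ^ 4 + (6 * X ^ 2 - 24 * X - 3), by monicity!, by
    simp; linear_combination hx⟩
  have key : ∀ r : ℤ, (p : ℤ) ∣ r ^ 4 + 6 * r ^ 2 - 24 * r - 3 →
      ¬ (p : ℤ) ^ 2 ∣ r ^ 4 + 6 * r ^ 2 - 24 * r - 3 → IsSignedNormValue β p := by
    intro r hr hr'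
    have hN : Ideal.absNorm (Ideal.span {(⟨x, h1⟩ - r : 𝓞 M)}) =
        (r ^ 4 + 6 * r ^ 2 - 24 * r - 3).natAbs := by
      rw [Ideal.absNorm_span_singleton]
      congr 1
      have h := quartic_norm hx hb (-r) 1 0 0
      have h' : algebraMap ℚ M (-r) + algebraMap ℚ M 1 * x + algebraMap ℚ M 0 * x ^ 2
          + algebraMap ℚ M 0 * x ^ 3 = ((⟨x, h1⟩ - r : 𝓞 M) : M) := by
        have h3 : ((⟨x, h1⟩ - r : 𝓞 M) : M) = x - r := by
          refine (map_sub (algebraMap (𝓞 M) M) _ _).trans ?_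
          rw [map_intCast]
          rfl
        rw [h3]
        simp
        ring
      rw [h', ← Algebra.coe_norm_int] at h
      have h2 : quarticNorm (-r : ℚ) 1 0 0 = ((r ^ 4 + 6 * r ^ 2 - 24 * r - 3 : ℤ) : ℚ) := by
        simp only [quarticNorm]; push_cast; ring
      exact_mod_cast h.trans h2
    refine isSignedNormValue_of_dvd_absNorm hβ hx hb hp (Ideal.span {(⟨x, h1⟩ - r : 𝓞 M)})
      (hN ▸ Int.natCast_dvd.1 hr) fun h ↦ hr' ?_
    rw [hN] at h
    exact_mod_cast Int.natCast_dvd.2 h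
  obtain ⟨r, hr⟩ := h
  obtain ⟨r, rfl⟩ := ZMod.intCast_surjective r
  have hr : (p : ℤ) ∣ r ^ 4 + 6 * r ^ 2 - 24 * r - 3 := by
    rw [← ZMod.intCast_zmod_eq_zero_iff_dvd]
    push_cast; exact hr
  by_cases hr' : (p : ℤ) ^ 2 ∣ r ^ 4 + 6 * r ^ 2 - 24 * r - 3
  · have hd : ¬ (p : ℤ) ∣ 4 * r ^ 3 + 12 * r - 24 := by
      intro h
      have h480 : (p : ℤ) ∣ (480 : ℕ) := by
        obtain ⟨k, hk⟩ := hr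
        obtain ⟨l, hl⟩ := h
        exact ⟨(-16 - 4 * r ^ 2) * k + (-18 + 7 * r + r ^ 3) * l, by
          push_cast
          linear_combination (-16 - 4 * r ^ 2) * hk + (-18 + 7 * r + r ^ 3) * hl⟩
      have := Int.natCast_dvd_natCast.1 h480
      exact hp30 (hp.dvd_of_dvd_pow (this.trans (by decide : 480 ∣ 30 ^ 5)))
    refine key (r + p) ?_ ?_
    · obtain ⟨k, hk⟩ := hr
      exact ⟨k + (4 * r ^ 3 + 12 * r - 24 + p * (6 * r ^ 2 + 6 + 4 * r * p + p ^ 2)), by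
        linear_combination hk⟩
    · rintro ⟨l, hl⟩
      obtain ⟨k, hk⟩ := hr'
      refine hd ⟨l - k - (6 * r ^ 2 + 6 + 4 * r * p + p ^ 2), ?_⟩
      refine mul_left_cancel₀ (by exact_mod_cast hp.ne_zero : (p : ℤ) ≠ 0) ?_
      linear_combination hl - hk
  · exact key r hr hr'

end Quartic

theorem irreducible_quartic : Irreducible (X ^ 4 + 6 * X ^ 2 - 24 * X - 3 : ℚ[X]) := by
  have hm : (X ^ 4 + (6 * X ^ 2 - 24 * X - 3) : ℤ[X]).Monic := by monicity!
  have hdeg : (X ^ 4 + (6 * X ^ 2 - 24 * X - 3) : ℤ[X]).natDegree = 4 := by compute_degree!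
  have hirr : Irreducible (X ^ 4 + (6 * X ^ 2 - 24 * X - 3) : ℤ[X]) := by
    have h3 : (Ideal.span {(3 : ℤ)}).IsPrime :=
      (Ideal.span_singleton_prime (by norm_num)).2 Int.prime_three
    refine irreducible_of_eisenstein_criterion h3 ?_ (fun n hn ↦ ?_) ?_ ?_ hm.isPrimitive
    · rw [hm.leadingCoeff, ← Ideal.ne_top_iff_one]
      exact h3.ne_top
    · rw [degree_eq_natDegree hm.ne_zero, hdeg, Nat.cast_lt] at hn
      rw [Ideal.mem_span_singleton]
      interval_cases n <;> simp [coeff_X, coeff_ofNat_mul]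
    · rw [degree_eq_natDegree hm.ne_zero, hdeg]
      norm_num
    · rw [Ideal.span_singleton_pow, Ideal.mem_span_singleton]
      simp
  have := (hm.irreducible_iff_irreducible_map_fraction_map (K := ℚ)).1 hirr
  convert this using 1
  simp [Polynomial.map_ofNat]
  ring

/-- For `p ∤ 30` the norm form of the quartic field represents `± p` up to squares as soon as the
quartic has a root modulo `p`. -/
theorem isSignedNormValue_of_root_zmod {K : Type*} [Field K] [CharZero K] {β : K}
    (hβ : β ^ 3 = 10) {p : ℕ} (hp : p.Prime) (hp30 : ¬ p ∣ 30)
    (h : ∃ r : ZMod p, r ^ 4 + 6 * r ^ 2 - 24 * r - 3 = 0) : IsSignedNormValue β p := by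
  have hirr := irreducible_quartic
  set g : ℚ[X] := X ^ 4 + 6 * X ^ 2 - 24 * X - 3 with hg
  have := Fact.mk hirr
  have hmon : g.Monic := by
    have : (X ^ 4 + (6 * X ^ 2 - 24 * X - 3) : ℚ[X]).Monic := by monicity!
    convert this using 1
    rw [hg]; ring
  have hdeg : g.natDegree = 4 := by rw [hg]; compute_degree!
  let pb := AdjoinRoot.powerBasis hirr.ne_zero
  have hdim : pb.dim = 4 := hdeg
  have := pb.finite
  have : NumberField (AdjoinRoot g) := ⟨⟩
  refine isSignedNormValue_of_root (M := AdjoinRoot g) (x := AdjoinRoot.root g)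
    (b := pb.basis.reindex (finCongr hdim)) hβ ?_ (fun i ↦ ?_) hp hp30 h
  · have := AdjoinRoot.eval₂_root g
    simpa [hg] using this
  · simp [pb]

theorem quartic_of_sq_eq {F : Type*} [Field F] {β c s₁ s₂ s₃ : F}
    (hc : c ^ 2 + c + 1 = 0) (h₁ : s₁ ^ 2 = β - 1) (h₂ : s₂ ^ 2 = c * β - 1)
    (h₃ : s₃ ^ 2 = c ^ 2 * β - 1) (h : s₁ * s₂ * s₃ = 3) :
    (s₁ + s₂ + s₃) ^ 4 + 6 * (s₁ + s₂ + s₃) ^ 2 - 24 * (s₁ + s₂ + s₃) - 3 = 0 := by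
  have e1 : s₁ ^ 2 + s₂ ^ 2 + s₃ ^ 2 = -3 := by rw [h₁, h₂, h₃]; linear_combination β * hc
  have e2 : s₁ ^ 2 * s₂ ^ 2 + s₂ ^ 2 * s₃ ^ 2 + s₃ ^ 2 * s₁ ^ 2 = 3 := by
    rw [h₁, h₂, h₃]; linear_combination (β ^ 2 * c - 2 * β) * hc
  linear_combination (s₁ ^ 2 + s₂ ^ 2 + s₃ ^ 2 + 3 + 4 * (s₁ * s₂ + s₂ * s₃ + s₃ * s₁)) * e1
    + 4 * e2 + 8 * (s₁ + s₂ + s₃) * h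

theorem exists_quartic_root_of_isSquare {p : ℕ} [Fact p.Prime] (hp30 : ¬ p ∣ 30) {b : ZMod p}
    (hb : b ^ 3 = 10) (hsq : ∀ b : ZMod p, b ^ 3 = 10 → IsSquare (b - 1)) :
    ∃ r : ZMod p, r ^ 4 + 6 * r ^ 2 - 24 * r - 3 = 0 := by
  have h30 : (30 : ZMod p) ≠ 0 := by
    rw [Ne, ← Nat.cast_ofNat, ZMod.natCast_eq_zero_iff]
    exact hp30
  have h2 : (2 : ZMod p) ≠ 0 := fun h ↦ h30 (by linear_combination 15 * h)
  have h3 : (3 : ZMod p) ≠ 0 := fun h ↦ h30 (by linear_combination 10 * h)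
  have h10 : (10 : ZMod p) ≠ 0 := fun h ↦ h30 (by linear_combination 3 * h)
  have hb0 : b ≠ 0 := by
    rintro rfl
    exact h10 (by rw [← hb]; ring)
  by_cases hz : IsSquare (-3 : ZMod p)
  · obtain ⟨z, hz⟩ := hz
    have hc : ((-1 + z) / 2) ^ 2 + (-1 + z) / 2 + 1 = 0 := by
      field_simp
      linear_combination -hz
    set c := (-1 + z) / 2
    have hc3 : c ^ 3 = 1 := by linear_combination (c - 1) * hc
    obtain ⟨s₁, h₁⟩ := hsq b hb
    obtain ⟨s₂, h₂⟩ := hsq (c * b) (by rw [mul_pow, hc3, hb, one_mul])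
    obtain ⟨s₃, h₃⟩ := hsq (c ^ 2 * b) (by
      rw [mul_pow, ← pow_mul, mul_comm 2, pow_mul, hc3, hb, one_pow, one_mul])
    have h9 : (s₁ * s₂ * s₃ - 3) * (s₁ * s₂ * s₃ + 3) = 0 := by
      have : (s₁ * s₂ * s₃) ^ 2 = (b - 1) * (c * b - 1) * (c ^ 2 * b - 1) := by
        rw [h₁, h₂, h₃]; ring
      linear_combination this + hb + b ^ 3 * hc3 - b * (c * b - 1) * hc
    rcases mul_eq_zero.1 h9 with h | h
    · exact ⟨_, quartic_of_sq_eq hc (by rw [h₁, sq]) (by rw [h₂, sq]) (by rw [h₃, sq])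
        (sub_eq_zero.1 h)⟩
    · exact ⟨_, quartic_of_sq_eq (s₁ := -s₁) hc (by rw [h₁, neg_sq, sq]) (by rw [h₂, sq])
        (by rw [h₃, sq]) (by linear_combination -h)⟩
  · obtain ⟨s, hs⟩ := hsq b hb
    have hs0 : s ≠ 0 := by
      rintro rfl
      have hb1 : b = 1 := by linear_combination hs
      rw [hb1] at hb
      exact h3 (mul_self_eq_zero.1 (by linear_combination -hb))
    have key : ∀ s : ZMod p, s ≠ 0 → b - 1 = s * s → IsSquare (-3 - s ^ 2 + 6 / s) →
        ∃ r : ZMod p, r ^ 4 + 6 * r ^ 2 - 24 * r - 3 = 0 := by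
      rintro s hs0 hs ⟨w, hw⟩
      refine ⟨s + w, ?_⟩
      have hw' : w ^ 2 * s = (-3 - s ^ 2) * s + 6 := by
        rw [sq, ← hw]; field_simp
      have hq : s ^ 6 + 3 * s ^ 4 + 3 * s ^ 2 - 9 = 0 := by
        have : b = s * s + 1 := by linear_combination hs
        rw [this] at hb
        linear_combination hb
      have hs2 : s ^ 2 ≠ 0 := pow_ne_zero 2 hs0
      refine (mul_eq_zero.1 (?_ : s ^ 2 * _ = 0)).resolve_left hs2
      linear_combination (w ^ 2 * s + 4 * s ^ 2 * w + 5 * s ^ 3 + 3 * s + 6) * hw' - 4 * hq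
    by_contra hno
    have n1 : ¬ IsSquare (-3 - s ^ 2 + 6 / s) := fun h ↦ hno (key s hs0 hs h)
    have n2 : ¬ IsSquare (-3 - (-s) ^ 2 + 6 / (-s)) := fun h ↦
      hno (key (-s) (neg_ne_zero.2 hs0) (by rw [hs]; ring) h)
    have hprod : (-3 - s ^ 2 + 6 / s) * (-3 - (-s) ^ 2 + 6 / (-s)) = -3 * b ^ 2 := by
      have : b = s * s + 1 := by linear_combination hs
      have hb' := hb
      rw [this] at hb' ⊢
      field_simp
      linear_combination 4 * hb'
    rw [← quadraticChar_neg_one_iff_not_isSquare] at n1 n2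
    have n3 := congrArg (quadraticChar (ZMod p)) hprod
    rw [map_mul, n1, n2, map_mul, map_pow, quadraticChar_sq_one hb0, mul_one,
      quadraticChar_neg_one_iff_not_isSquare.2 hz] at n3
    norm_num at n3

theorem exists_quartic_root_of_forall_ne {p : ℕ} [Fact p.Prime] (hp30 : ¬ p ∣ 30)
    (hb : ∀ b : ZMod p, b ^ 3 ≠ 10) :
    ∃ r : ZMod p, r ^ 4 + 6 * r ^ 2 - 24 * r - 3 = 0 := by
  have hp : p.Prime := Fact.out
  have h30 : (30 : ZMod p) ≠ 0 := by
    rw [Ne, ← Nat.cast_ofNat, ZMod.natCast_eq_zero_iff]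
    exact hp30
  have hirr := X_pow_sub_C_irreducible_of_prime Nat.prime_three hb
  have := Fact.mk hirr
  set f : (ZMod p)[X] := X ^ 3 - C 10 with hf
  let E := AdjoinRoot f
  let pb := AdjoinRoot.powerBasis hirr.ne_zero
  have := pb.finite
  have hfr : finrank (ZMod p) E = 3 := by
    rw [pb.finrank]
    exact natDegree_X_pow_sub_C
  have : Finite E := Module.finite_of_finite (ZMod p)
  have := Fintype.ofFinite E
  have hcard : Fintype.card E = p ^ 3 := by
    rw [Module.card_eq_pow_finrank (K := ZMod p), ZMod.card, hfr]
  have hE : ∀ y : E, ((y ^ p) ^ p) ^ p = y := fun y ↦ by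
    rw [← pow_mul, ← pow_mul, ← pow_three]
    have := FiniteField.pow_card y
    rwa [hcard] at this
  have : CharP E p := charP_of_injective_algebraMap (algebraMap (ZMod p) E).injective p
  have hfix : ∀ y : E, y ^ p = y → ∃ a : ZMod p, algebraMap (ZMod p) E a = y := fun y hy ↦ by
    have : y ∈ (⊥ : Subfield E) := (Subfield.mem_bot_iff_pow_eq_self E p).2 hy
    exact (bot_le : ⊥ ≤ (algebraMap (ZMod p) E).fieldRange) this
  have h30E : (30 : E) ≠ 0 := by
    have := (map_ne_zero (algebraMap (ZMod p) E)).2 h30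
    rwa [map_ofNat] at this
  have h3 : (3 : E) ≠ 0 := fun h ↦ h30E (by linear_combination 10 * h)
  have hp2 : p ≠ 2 := by rintro rfl; exact hp30 (by decide)
  have hodd : Odd p := hp.odd_of_ne_two hp2
  set β : E := AdjoinRoot.root f with hβdef
  have hβ : β ^ 3 = 10 := by
    have := AdjoinRoot.eval₂_root f
    rw [hf] at this
    simp at this
    exact sub_eq_zero.1 this
  have hβ0 : β ≠ 0 := by
    intro h
    rw [h] at hβ
    exact h30E (by linear_combination -3 * hβ)
  have hc1 : β ^ p / β ≠ 1 := by
    intro h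
    obtain ⟨a, ha⟩ := hfix β ((div_eq_one_iff_eq hβ0).1 h)
    refine hb a ((algebraMap (ZMod p) E).injective ?_)
    rw [map_pow, ha, hβ, map_ofNat]
  have hβp : β ^ p = β ^ p / β * β := (div_mul_cancel₀ _ hβ0).symm
  have h10p : (10 : E) ^ p = 10 := by
    have := congrArg (algebraMap (ZMod p) E) (ZMod.pow_card (10 : ZMod p))
    rwa [map_pow, map_ofNat] at this
  have hc3 : (β ^ p / β) ^ 3 = 1 := by
    rw [div_pow, ← pow_mul, mul_comm, pow_mul, hβ, h10p, div_self]
    exact fun h ↦ h30E (by linear_combination 3 * h)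
  set c := β ^ p / β
  have hc : c ^ 2 + c + 1 = 0 :=
    (mul_eq_zero.1 (by linear_combination hc3 : (c - 1) * (c ^ 2 + c + 1) = 0)).resolve_left
      (sub_ne_zero.2 hc1)
  have hcp : c ^ p = c := by
    have h : (c ^ p - 1) * ((c ^ p - c) * (c ^ p - c ^ 2)) = 0 := by
      have : (c ^ p) ^ 3 = 1 := by rw [← pow_mul, mul_comm, pow_mul, hc3, one_pow]
      linear_combination this - c ^ p * (c ^ p - 1) * hc + (c ^ p - 1) * hc3
    have hne : ∀ z : E, z ^ p = 1 → z = 1 := fun z hz ↦ by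
      rw [← hE z, hz, one_pow, one_pow]
    rcases mul_eq_zero.1 h with h | h
    · exact absurd (hne c (sub_eq_zero.1 h)) hc1
    rcases mul_eq_zero.1 h with h | h
    · exact sub_eq_zero.1 h
    · have h := sub_eq_zero.1 h
      have h1 : (β ^ p) ^ p = β := by
        rw [hβp, mul_pow, h, hβp]
        linear_combination β * hc3
      have h2 := hE β
      rw [h1] at h2
      exact absurd ((div_eq_one_iff_eq hβ0).2 h2) hc1
  have hθp : (β - 1) ^ p = c * β - 1 := by rw [sub_pow_char, one_pow, hβp]
  have hθp2 : (c * β - 1) ^ p = c ^ 2 * β - 1 := by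
    rw [sub_pow_char, one_pow, mul_pow, hcp, hβp]; ring
  have hprod : (β - 1) * (c * β - 1) * (c ^ 2 * β - 1) = 9 := by
    linear_combination hβ + β ^ 3 * hc3 - β * (c * β - 1) * hc
  have hθ0 : β - 1 ≠ 0 := fun h ↦ by
    rw [h] at hprod
    exact h3 (mul_self_eq_zero.1 (by linear_combination -hprod))
  have hchar : ringChar E ≠ 2 := by rwa [ringChar.eq E p]
  obtain ⟨s, hs⟩ : IsSquare (β - 1) := by
    rw [FiniteField.isSquare_iff hchar hθ0, hcard]
    obtain ⟨k, rfl⟩ := hodd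
    have : (2 * k + 1) ^ 3 / 2 = (1 + (2 * k + 1) + (2 * k + 1) * (2 * k + 1)) * k := by
      have : (2 * k + 1) ^ 3 = 2 * ((1 + (2 * k + 1) + (2 * k + 1) * (2 * k + 1)) * k) + 1 := by
        ring
      omega
    rw [this, pow_mul, pow_add, pow_add, pow_one, pow_mul, hθp, hθp2, hprod]
    have h3p : (3 : E) ^ (2 * k + 1) = 3 := by
      have := congrArg (algebraMap (ZMod (2 * k + 1)) E) (ZMod.pow_card (3 : ZMod (2 * k + 1)))
      rwa [map_pow, map_ofNat] at this
    have : (3 : E) * (9 ^ k - 1) = 0 := by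
      have h9 : (9 : E) = 3 ^ 2 := by norm_num
      rw [h9, ← pow_mul]
      linear_combination h3p
    exact sub_eq_zero.1 ((mul_eq_zero.1 this).resolve_left h3)
  have key : ∀ s : E, β - 1 = s * s → s * s ^ p * (s ^ p) ^ p = 3 →
      ∃ r : ZMod p, r ^ 4 + 6 * r ^ 2 - 24 * r - 3 = 0 := by
    intro s hs h
    obtain ⟨r, hr⟩ := hfix (s + s ^ p + (s ^ p) ^ p) (by
      rw [add_pow_char, add_pow_char, hE]; ring)
    refine ⟨r, (algebraMap (ZMod p) E).injective ?_⟩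
    rw [map_quartic, hr, map_zero]
    have h2 : (s ^ p) ^ 2 = c * β - 1 := by rw [← hθp, hs]; ring
    exact quartic_of_sq_eq hc (by rw [hs, sq]) h2 (by rw [← hθp2, ← h2]; ring) h
  have h9 : (s * s ^ p * (s ^ p) ^ p - 3) * (s * s ^ p * (s ^ p) ^ p + 3) = 0 := by
    rw [← hθp2, ← hθp, hs] at hprod
    linear_combination hprod
  rcases mul_eq_zero.1 h9 with h | h
  · exact key s hs (sub_eq_zero.1 h)
  · refine key (-s) (by rw [hs]; ring) ?_
    rw [hodd.neg_pow, hodd.neg_pow]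
    linear_combination -h

theorem isSquare_of_forall_finiteDimensional {p : ℕ} [Fact p.Prime] (hp30 : ¬ p ∣ 30)
    (hloc : ∀ (L : Type) [Field L] [Algebra ℚ_[p] L] [FiniteDimensional ℚ_[p] L],
        ∀ θ : L, θ ^ 3 + 3 * θ ^ 2 + 3 * θ - 9 = 0 → Algebra.adjoin ℚ_[p] {θ} = ⊤ →
          ∃ s : L, s ^ 2 = θ) {b : ZMod p} (hb : b ^ 3 = 10) : IsSquare (b - 1) := by
  have h30 : (30 : ZMod p) ≠ 0 := by
    rw [Ne, ← Nat.cast_ofNat, ZMod.natCast_eq_zero_iff]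
    exact hp30
  have hnorm : ∀ y : ℤ_[p], ‖y‖ < 1 ↔ PadicInt.toZMod y = 0 := fun y ↦ by
    rw [← RingHom.mem_ker, PadicInt.ker_toZMod, PadicInt.maximalIdeal_eq_span_p,
      Ideal.mem_span_singleton, PadicInt.norm_lt_one_iff_dvd]
  obtain ⟨a, rfl⟩ := ZMod.ringHom_surjective (PadicInt.toZMod (p := p)) b
  have hb0 : PadicInt.toZMod a ≠ 0 := fun h ↦ h30 (by rw [h] at hb; linear_combination -3 * hb)
  have hF : ∀ a : ℤ_[p], aeval a (X ^ 3 - 10 : ℤ[X]) = a ^ 3 - 10 := by simp [map_ofNat]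
  have hF' : ∀ a : ℤ_[p], aeval a (derivative (X ^ 3 - 10 : ℤ[X])) = 3 * a ^ 2 := by simp [map_ofNat]
  obtain ⟨z, hz, hza, -⟩ := hensels_lemma (F := (X ^ 3 - 10 : ℤ[X])) (a := a) (by
    have h1 : ‖3 * a ^ 2‖ = 1 := by
      refine le_antisymm (PadicInt.norm_le_one _) (not_lt.1 fun h ↦ ?_)
      rw [hnorm, map_mul, map_pow, map_ofNat] at h
      rcases mul_eq_zero.1 h with h | h
      · exact h30 (by linear_combination 10 * h)
      · exact hb0 (pow_eq_zero_iff two_ne_zero |>.1 h)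
    rw [hF, hF', h1, one_pow, hnorm, map_sub, map_pow, hb, map_ofNat, sub_self])
  rw [hF'] at hza
  rw [hF] at hz
  have hza : PadicInt.toZMod z = PadicInt.toZMod a := by
    have := (hnorm _).1 (hza.trans_le (PadicInt.norm_le_one _))
    rwa [map_sub, sub_eq_zero] at this
  have hzQ : ((z : ℚ_[p])) ^ 3 - 10 = 0 := by exact_mod_cast congrArg ((↑) : ℤ_[p] → ℚ_[p]) hz
  obtain ⟨s, hs⟩ := hloc ℚ_[p] ((z : ℚ_[p]) - 1) (by linear_combination hzQ)
    (Subsingleton.elim _ _)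
  have hs1 : ‖s‖ ≤ 1 := by
    have : ‖s‖ ^ 2 ≤ 1 := by
      rw [← norm_pow, hs]
      exact_mod_cast PadicInt.norm_le_one (z - 1)
    nlinarith [norm_nonneg s]
  let s' : ℤ_[p] := ⟨s, hs1⟩
  have hs' : s' ^ 2 = z - 1 := by
    apply PadicInt.ext
    push_cast
    exact hs
  refine ⟨PadicInt.toZMod s', ?_⟩
  rw [← sq, ← map_pow, hs', map_sub, map_one, hza]

theorem exists_padic_cube_root : ∃ t : ℤ_[3], PadicInt.toZMod t = 1 ∧ (1 + 3 * t) ^ 3 = 10 := by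
  have hnorm : ∀ y : ℤ_[3], ‖y‖ < 1 ↔ PadicInt.toZMod y = 0 := fun y ↦ by
    rw [← RingHom.mem_ker, PadicInt.ker_toZMod, PadicInt.maximalIdeal_eq_span_p,
      Ideal.mem_span_singleton, PadicInt.norm_lt_one_iff_dvd]
  have hF : ∀ a : ℤ_[3], aeval a (3 * X ^ 3 + 3 * X ^ 2 + X - 1 : ℤ[X]) =
      3 * a ^ 3 + 3 * a ^ 2 + a - 1 := by simp [map_ofNat]
  have hF' : ∀ a : ℤ_[3], aeval a (derivative (3 * X ^ 3 + 3 * X ^ 2 + X - 1 : ℤ[X])) =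
      9 * a ^ 2 + 6 * a + 1 := fun a ↦ by
    simp [map_ofNat]
    ring
  obtain ⟨z, hz, hza, -⟩ := hensels_lemma (F := (3 * X ^ 3 + 3 * X ^ 2 + X - 1 : ℤ[X]))
    (a := (1 : ℤ_[3])) (by
      have h1 : ‖(9 * 1 ^ 2 + 6 * 1 + 1 : ℤ_[3])‖ = 1 := by
        refine le_antisymm (PadicInt.norm_le_one _) (not_lt.1 fun h ↦ ?_)
        rw [hnorm] at h
        simp [map_ofNat] at h
        revert h
        decide
      rw [hF, hF', h1, one_pow (M := ℝ), hnorm]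
      simp [map_ofNat]
      decide)
  rw [hF] at hz
  refine ⟨z, ?_, by linear_combination 9 * hz⟩
  have := (hnorm _).1 (hza.trans_le (PadicInt.norm_le_one _))
  rwa [map_sub, sub_eq_zero, map_one] at this

theorem three_dvd_of_sq_sub {t x y e : ℤ_[3]} (ht : PadicInt.toZMod t = 1)
    (d : ℤ_[3]) (he : 3 ∣ e) (h : d * e ^ 2 = x ^ 2 - 3 * t * y ^ 2) : 3 ∣ x ∧ 3 ∣ y := by
  have hdvd : ∀ y : ℤ_[3], PadicInt.toZMod y = 0 ↔ 3 ∣ y := fun y ↦ by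
    rw [← RingHom.mem_ker, PadicInt.ker_toZMod, PadicInt.maximalIdeal_eq_span_p,
      Ideal.mem_span_singleton]
    rfl
  have h3 : (3 : ZMod 3) = 0 := rfl
  obtain ⟨e, rfl⟩ := he
  have hx : 3 ∣ x := by
    rw [← hdvd]
    have := congrArg PadicInt.toZMod h
    simp only [map_mul, map_sub, map_pow, map_ofNat, h3] at this
    exact pow_eq_zero_iff two_ne_zero |>.1 (by linear_combination -this)
  refine ⟨hx, ?_⟩
  obtain ⟨x, rfl⟩ := hx
  have h' : 3 * d * e ^ 2 = 3 * x ^ 2 - t * y ^ 2 := by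
    have h30 : (3 : ℤ_[3]) ≠ 0 := by norm_num
    refine mul_left_cancel₀ h30 ?_
    linear_combination h
  rw [← hdvd]
  have := congrArg PadicInt.toZMod h'
  simp only [map_mul, map_sub, map_pow, map_ofNat, h3, ht] at this
  exact pow_eq_zero_iff two_ne_zero |>.1 (by linear_combination this)

theorem padic_ne_sq_sub {t : ℤ_[3]} (ht : PadicInt.toZMod t = 1) {d : ℤ} (hd : (d : ZMod 3) = 2)
    (x y : ℚ_[3]) : (d : ℚ_[3]) ≠ x ^ 2 - 3 * t * y ^ 2 := by
  intro h
  have hcase : ∀ x y e : ℤ_[3], (3 ∣ e ∨ e = 1) → ¬ (3 ∣ x ∧ 3 ∣ y ∧ 3 ∣ e) →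
      (d : ℤ_[3]) * e ^ 2 = x ^ 2 - 3 * t * y ^ 2 → False := by
    rintro x y e (he | rfl) hn h
    · exact hn ⟨(three_dvd_of_sq_sub ht d he h).1, (three_dvd_of_sq_sub ht d he h).2, he⟩
    · have := congrArg PadicInt.toZMod h
      have h3 : (3 : ZMod 3) = 0 := rfl
      simp only [map_mul, map_sub, map_pow, map_ofNat, h3, ht, map_intCast, hd, map_one] at this
      generalize PadicInt.toZMod x = u at this
      generalize PadicInt.toZMod y = v at this
      revert u v
      decide
  have hlift : ∀ x y e : ℚ_[3], ‖x‖ ≤ 1 → ‖y‖ ≤ 1 → (‖e‖ < 1 ∨ e = 1) →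
      (‖x‖ = 1 ∨ ‖y‖ = 1 ∨ ‖e‖ = 1) → (d : ℚ_[3]) * e ^ 2 = x ^ 2 - 3 * t * y ^ 2 → False := by
    intro x y e hx hy he hn h
    have he1 : ‖e‖ ≤ 1 := by
      rcases he with h | rfl
      · exact h.le
      · simp
    have hd3 : ∀ z : ℤ_[3], 3 ∣ z ↔ ‖(z : ℚ_[3])‖ < 1 := fun z ↦
      (PadicInt.norm_lt_one_iff_dvd z).symm
    obtain ⟨x, rfl⟩ : ∃ z : ℤ_[3], (z : ℚ_[3]) = x := ⟨⟨x, hx⟩, rfl⟩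
    obtain ⟨y, rfl⟩ : ∃ z : ℤ_[3], (z : ℚ_[3]) = y := ⟨⟨y, hy⟩, rfl⟩
    obtain ⟨e, rfl⟩ : ∃ z : ℤ_[3], (z : ℚ_[3]) = e := ⟨⟨e, he1⟩, rfl⟩
    refine hcase x y e ?_ ?_ (PadicInt.ext (by push_cast; exact h))
    · rw [hd3]
      exact he.imp_right fun h ↦ PadicInt.ext (by push_cast; exact h)
    · rw [hd3, hd3, hd3]
      rintro ⟨h1, h2, h3⟩
      rcases hn with h | h | h
      · exact h1.ne h
      · exact h2.ne h
      · exact h3.ne h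
  have hscale : ∀ c : ℚ_[3], 1 < ‖c‖ → ‖x‖ ≤ ‖c‖ → ‖y‖ ≤ ‖c‖ → (c = x ∨ c = y) → False := by
    intro c hc hx hy hcxy
    have hc0 : c ≠ 0 := by
      rintro rfl
      simp at hc
      linarith
    have hpos : 0 < ‖c‖ := by linarith
    refine hlift (x / c) (y / c) c⁻¹ ?_ ?_ (.inl ?_) ?_ ?_
    · rw [norm_div]; exact div_le_one_of_le₀ hx hpos.le
    · rw [norm_div]; exact div_le_one_of_le₀ hy hpos.le
    · rw [norm_inv]; exact inv_lt_one_of_one_lt₀ hc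
    · rcases hcxy with rfl | rfl
      · exact .inl (by rw [div_self hc0, norm_one])
      · exact .inr (.inl (by rw [div_self hc0, norm_one]))
    · rw [h]; field_simp
  by_cases hx : ‖x‖ ≤ 1
  · by_cases hy : ‖y‖ ≤ 1
    · exact hlift x y 1 hx hy (.inr rfl) (.inr (.inr (by simp))) (by rw [h]; ring)
    · push Not at hy
      exact hscale y hy (hx.trans hy.le) le_rfl (.inr rfl)
  · push Not at hx
    rcases le_total ‖x‖ ‖y‖ with hxy | hxy
    · exact hscale y (hx.trans_le hxy) hxy le_rfl (.inr rfl)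
    · exact hscale x hx le_rfl hxy (.inl rfl)

section

variable {K : Type*} [Field K] [CharZero K] {β : K}

theorem isSignedNormValue_of_forall_prime {n : ℕ} (hn : n ≠ 0)
    (h : ∀ p : ℕ, p.Prime → p ∣ n → IsSignedNormValue β p) : IsSignedNormValue β n := by
  induction n using UniqueFactorizationMonoid.induction_on_prime with
  | h₁ => exact absurd rfl hn
  | h₂ n hu =>
    rw [Nat.isUnit_iff.1 hu, Nat.cast_one]
    exact .inl (by simpa using IsNormValue.sq β 1)
  | h₃ n p hn0 hp ih =>
    rw [Nat.cast_mul]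
    exact (h p hp.nat_prime (dvd_mul_right _ _)).mul
      (ih hn0 fun q hq hqn ↦ h q hq (hqn.mul_left _))

theorem isSignedNormValue_of_dvd (hβ : β ^ 3 = 10) {p : ℕ} [hp : Fact p.Prime] (h2 : p ≠ 2)
    (h3 : p ≠ 3)
    (hloc : ∀ (L : Type) [Field L] [Algebra ℚ_[p] L] [FiniteDimensional ℚ_[p] L],
        ∀ θ : L, θ ^ 3 + 3 * θ ^ 2 + 3 * θ - 9 = 0 → Algebra.adjoin ℚ_[p] {θ} = ⊤ →
          ∃ s : L, s ^ 2 = θ) : IsSignedNormValue β p := by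
  by_cases h5 : p = 5
  · subst h5
    exact isSignedNormValue_of_prime_le hβ hp.out (by norm_num) (.inl le_rfl)
  have h30 : ¬ p ∣ 30 := by
    intro h
    have hle := Nat.le_of_dvd (by norm_num) h
    have hp' := hp.out
    clear hloc hp
    interval_cases p <;> first | omega | (revert hp'; decide)
  refine isSignedNormValue_of_root_zmod hβ hp.out h30 ?_
  by_cases hb : ∃ b : ZMod p, b ^ 3 = 10
  · obtain ⟨b, hb⟩ := hb
    exact exists_quartic_root_of_isSquare h30 hb fun b hb ↦
      isSquare_of_forall_finiteDimensional h30 hloc hb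
  · push Not at hb
    exact exists_quartic_root_of_forall_ne h30 hb

theorem isNormValue_neg (hβ : β ^ 3 = 10) {t : ℤ_[3]} (ht : PadicInt.toZMod t = 1)
    (φ : K →+* ℚ_[3]) (hφ : φ β = 1 + 3 * t) {d : ℤ} (hd : d ≡ 5 [ZMOD 12])
    (hloc : ∀ (p : ℕ) [Fact p.Prime], (p : ℤ) ∣ d →
      ∀ (L : Type) [Field L] [Algebra ℚ_[p] L] [FiniteDimensional ℚ_[p] L],
        ∀ θ : L, θ ^ 3 + 3 * θ ^ 2 + 3 * θ - 9 = 0 → Algebra.adjoin ℚ_[p] {θ} = ⊤ →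
          ∃ s : L, s ^ 2 = θ) : IsNormValue β (-d) := by
  have hd12 : d % 12 = 5 := hd
  have hs : IsSignedNormValue β d := by
    rw [← IsSignedNormValue.abs_iff, ← Int.cast_abs, ← Nat.cast_natAbs]
    refine isSignedNormValue_of_forall_prime (by omega) fun p hp hpd ↦ ?_
    have := Fact.mk hp
    have hpd' := Int.natCast_dvd.2 hpd
    refine isSignedNormValue_of_dvd hβ ?_ ?_ (hloc p hpd')
    · rintro rfl; norm_num at hpd'; omega
    · rintro rfl; norm_num at hpd'; omega
  refine hs.resolve_left ?_
  rintro ⟨x, y, h⟩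
  have h := congrArg φ h
  rw [map_sub, map_mul, map_pow, map_pow, map_sub, hφ, map_one] at h
  refine padic_ne_sq_sub ht (d := d) ?_ (φ x) (φ y) ?_
  · have : (d : ZMod 3) = ((d % 12 : ℤ) : ZMod 3) := by
      rw [ZMod.intCast_eq_intCast_iff_dvd_sub]
      norm_num; omega
    rw [this, hd12]
    rfl
  · rw [Rat.cast_intCast, map_intCast] at h
    rw [h]; ring

end

/-- A cubic field containing a cube root of `10`, with a place over `3`. -/
theorem exists_cubic_field : ∃ (K : Type) (_ : Field K) (_ : Algebra ℚ K)
    (_ : FiniteDimensional ℚ K) (β : K) (φ : K →+* ℚ_[3]) (t : ℤ_[3]), finrank ℚ K = 3 ∧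
      β ^ 3 = 10 ∧ PadicInt.toZMod t = 1 ∧ φ β = 1 + 3 * t := by
  obtain ⟨t, ht, ht10⟩ := exists_padic_cube_root
  have hirr : Irreducible (X ^ 3 - C 10 : ℚ[X]) := by
    refine X_pow_sub_C_irreducible_of_prime Nat.prime_three fun b hb ↦ ?_
    have hb' : IsIntegral ℤ b := ⟨X ^ 3 - C 10, monic_X_pow_sub_C _ (by norm_num), by simp [hb]⟩
    obtain ⟨n, rfl⟩ := IsIntegrallyClosed.isIntegral_iff.1 hb'
    rw [eq_intCast] at hb
    have hb : n ^ 3 = 10 := by exact_mod_cast hb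
    have h1 : n < 3 := by nlinarith [sq_nonneg (n + 3), sq_nonneg n]
    have h2 : 2 < n := by nlinarith [sq_nonneg (n + 2), sq_nonneg n]
    omega
  have := Fact.mk hirr
  let pb := AdjoinRoot.powerBasis hirr.ne_zero
  have h10 : ((1 : ℚ_[3]) + 3 * t) ^ 3 = 10 := by
    exact_mod_cast congrArg ((↑) : ℤ_[3] → ℚ_[3]) ht10
  refine ⟨AdjoinRoot (X ^ 3 - C 10 : ℚ[X]), inferInstance, inferInstance, pb.finite,
    AdjoinRoot.root _, AdjoinRoot.lift (algebraMap ℚ ℚ_[3]) (1 + 3 * t) (by simp [h10]), t, ?_, ?_,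
    ht, AdjoinRoot.lift_root _⟩
  · rw [pb.finrank]
    exact natDegree_X_pow_sub_C
  · have := AdjoinRoot.eval₂_root (X ^ 3 - C 10 : ℚ[X])
    simp at this
    exact sub_eq_zero.1 this

/-- Over an extension of degree `1` or `2`, a given element becomes a square. -/
theorem exists_field_isSquare (F : Type) [Field F] [Algebra ℚ F] [FiniteDimensional ℚ F] (a : F) :
    ∃ (L : Type) (_ : Field L) (_ : Algebra ℚ L) (_ : FiniteDimensional ℚ L) (φ : F →+* L),
      (finrank ℚ L = finrank ℚ F ∨ finrank ℚ L = 2 * finrank ℚ F) ∧ ∃ r : L, r ^ 2 = φ a := by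
  by_cases ha : ∃ r : F, r ^ 2 = a
  · exact ⟨F, inferInstance, inferInstance, inferInstance, .id F, .inl rfl, ha⟩
  · have hirr : Irreducible (X ^ 2 - C a : F[X]) :=
      X_pow_sub_C_irreducible_of_prime Nat.prime_two fun b hb ↦ ha ⟨b, hb⟩
    have := Fact.mk hirr
    let pb := AdjoinRoot.powerBasis hirr.ne_zero
    have := pb.finite
    refine ⟨AdjoinRoot (X ^ 2 - C a : F[X]), inferInstance, inferInstance,
      FiniteDimensional.trans ℚ F _, AdjoinRoot.of _, .inr ?_, AdjoinRoot.root _, ?_⟩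
    · rw [← finrank_mul_finrank ℚ F, pb.finrank, mul_comm]
      congr 1
      exact natDegree_X_pow_sub_C
    · have := AdjoinRoot.eval₂_root (X ^ 2 - C a : F[X])
      simp at this
      exact sub_eq_zero.1 this

/-- The surface has a point of degree dividing `4`. -/
theorem exists_mem_degrees_dvd_four (d : ℤ) : ∃ n ∈ Degrees d, n ∣ 4 := by
  obtain ⟨F, _, _, _, φ, hF, r, hr⟩ := exists_field_isSquare ℚ 3
  obtain ⟨L, _, _, _, ψ, hL, s, hs⟩ := exists_field_isSquare F (-2 * d * r)
  refine ⟨finrank ℚ L, ⟨L, _, _, inferInstance, rfl, ![ψ r, 1, 0, 0, s], ?_, ?_, ?_⟩, ?_⟩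
  · exact fun h ↦ one_ne_zero (congrFun h 1)
  · have h : ψ r ^ 2 = 3 := by rw [← map_pow, hr]; simp [map_ofNat]
    simp [Q0, h]
  · simp [map_ofNat] at hs
    simp [Qinf, hs]
  · rw [finrank_self] at hF
    rcases hF with hF | hF <;> rcases hL with hL | hL <;> rw [hL, hF] <;> norm_num

/-- A plane on which a degenerate member of the pencil vanishes identically. -/
def planeVec {K : Type*} [Field K] (d : ℤ) (β a b l m : K) : Fin 5 → K :=
  let X := l * (2 + β) + m * (4 + 12 * β - 4 * β ^ 2)
  let Y := l * (2 + β - β ^ 2) + m * (4 * β + β ^ 2)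
  let s := -2 + 4 * β + β ^ 2
  ![3 * (1 - β ^ 2) * (a * Y - b * X) + s * (a * X - (β - 1) * b * Y), 3 * (a * Y - b * X),
    d * s * (l * (1 - β) + m * (3 + β + 2 * β ^ 2)), d * s * (l * (-1 + β)),
    d * s * (l * β ^ 2 + m * (3 - 5 * β - 3 * β ^ 2))]

theorem Q0_planeVec {K : Type*} [Field K] {d : ℤ} {β a b : K} (hβ : β ^ 3 = 10)
    (h : -(d : K) = a ^ 2 - (β - 1) * b ^ 2) (l m : K) :
    Q0 d (planeVec d β a b l m) = -(1 - β ^ 2) * Qinf d (planeVec d β a b l m) := by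
  have h1 : 9 * ((1 - β ^ 2) ^ 2 + 3) = (β - 1) * (-2 + 4 * β + β ^ 2) ^ 2 := by
    grind
  have h2 : ∀ X Y x y z : K, X = l * (2 + β) + m * (4 + 12 * β - 4 * β ^ 2) →
    Y = l * (2 + β - β ^ 2) + m * (4 * β + β ^ 2) →
    x = l * (1 - β) + m * (3 + β + 2 * β ^ 2) → y = l * (-1 + β) →
    z = l * β ^ 2 + m * (3 - 5 * β - 3 * β ^ 2) → 6 * x ^ 2 + 6 * x * y - 6 * y * z +
      (1 - β ^ 2) * (x ^ 2 - 2 * x * z - 3 * y ^ 2 - z ^ 2) = X ^ 2 - (β - 1) * Y ^ 2 := by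
    rintro X Y x y z rfl rfl rfl rfl rfl
    grind
  have h2 := h2 _ _ _ _ _ rfl rfl rfl rfl rfl
  simp only [Q0, Qinf, planeVec, Matrix.cons_val]
  generalize l * (2 + β) + m * (4 + 12 * β - 4 * β ^ 2) = X at *
  generalize l * (2 + β - β ^ 2) + m * (4 * β + β ^ 2) = Y at *
  generalize l * (1 - β) + m * (3 + β + 2 * β ^ 2) = x at *
  generalize l * (-1 + β) = y at *
  generalize l * β ^ 2 + m * (3 - 5 * β - 3 * β ^ 2) = z at *
  generalize -2 + 4 * β + β ^ 2 = s at *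
  linear_combination (-d * (a * Y - b * X) ^ 2) * h1 + d ^ 2 * s ^ 2 * h2 -
    d * s ^ 2 * (X ^ 2 - (β - 1) * Y ^ 2) * h

theorem map_planeVec {K L : Type*} [Field K] [Field L] (φ : K →+* L) (d : ℤ) (β a b l m : K) :
    φ ∘ planeVec d β a b l m = planeVec d (φ β) (φ a) (φ b) (φ l) (φ m) := by
  ext i; fin_cases i <;> simp [planeVec, map_ofNat]

theorem map_Qinf {K L : Type*} [Field K] [Field L] (φ : K →+* L) (d : ℤ) (u : Fin 5 → K) :
    Qinf d (φ ∘ u) = φ (Qinf d u) := by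
  simp [Qinf, map_ofNat]

theorem Qinf_planeVec {K : Type*} [Field K] (d : ℤ) (β a b l m : K) :
    Qinf d (planeVec d β a b l m) = l ^ 2 * Qinf d (planeVec d β a b 1 0) + l * m *
      (Qinf d (planeVec d β a b 1 1) - Qinf d (planeVec d β a b 1 0) -
        Qinf d (planeVec d β a b 0 1)) + m ^ 2 * Qinf d (planeVec d β a b 0 1) := by
  simp only [Qinf, planeVec, Matrix.cons_val]
  ring

theorem planeVec_ne_zero {K : Type*} [Field K] [CharZero K] {d : ℤ} (hd : d ≠ 0) {β a b : K}
    (hβ : β ^ 3 = 10) {l m : K} (h : l ≠ 0 ∨ m ≠ 0) : planeVec d β a b l m ≠ 0 := by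
  intro h0
  have h3 := congrFun h0 3
  have h2 := congrFun h0 2
  have hd' : (d : K) ≠ 0 := by exact_mod_cast hd
  have hs : -2 + 4 * β + β ^ 2 ≠ 0 := fun hs ↦ by
    have : (54 : K) = 0 := by
      linear_combination (-2 + β + β ^ 2) * hs - (5 + β) * hβ
    norm_num at this
  have hb : -1 + β ≠ 0 := fun hb ↦ by
    have : (9 : K) = 0 := by linear_combination (β ^ 2 + β + 1) * hb - hβ
    norm_num at this
  have hf : 3 + β + 2 * β ^ 2 ≠ 0 := fun hs ↦ by
    have : (657 : K) = 0 := by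
      linear_combination (-11 + 37 * β - 5 * β ^ 2) * hs - (69 - 10 * β) * hβ
    norm_num at this
  simp [planeVec, hd', hs, hb] at h3 h2
  subst h3
  simp [hf] at h2
  simp [h2] at h

/-- A point of degree dividing `6`, from the vanishing of a quadratic form on a plane. -/
theorem exists_mem_degrees_dvd_six {K : Type} [Field K] [Algebra ℚ K] [FiniteDimensional ℚ K]
    (h3 : finrank ℚ K = 3) {d : ℤ} (hd : d ≠ 0) {β a b : K} (hβ : β ^ 3 = 10)
    (h : -(d : K) = a ^ 2 - (β - 1) * b ^ 2) : ∃ n ∈ Degrees d, n ∣ 6 := by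
  set A := Qinf d (planeVec d β a b 1 0) with hA
  set C := Qinf d (planeVec d β a b 0 1) with hC
  set B := Qinf d (planeVec d β a b 1 1) - A - C with hB
  obtain ⟨L, _, _, _, φ, hL, r, hr⟩ := exists_field_isSquare K (B ^ 2 - 4 * A * C)
  have hφβ : φ β ^ 3 = 10 := by rw [← map_pow, hβ]; simp [map_ofNat]
  have hφ : -(d : L) = φ a ^ 2 - (φ β - 1) * φ b ^ 2 := by
    simpa using congrArg φ h
  have key : ∀ l m : L, Qinf d (planeVec d (φ β) (φ a) (φ b) l m) =
      l ^ 2 * φ A + l * m * φ B + m ^ 2 * φ C := fun l m ↦ by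
    rw [Qinf_planeVec, hB, map_sub, map_sub, hA, hC, ← map_Qinf, ← map_Qinf, ← map_Qinf,
      map_planeVec, map_planeVec, map_planeVec, map_one, map_zero]
  have : CharZero L := algebraRat.charZero L
  obtain ⟨l, m, hlm, h0⟩ : ∃ l m : L, (l ≠ 0 ∨ m ≠ 0) ∧
      l ^ 2 * φ A + l * m * φ B + m ^ 2 * φ C = 0 := by
    by_cases hA0 : φ A = 0
    · exact ⟨1, 0, by simp, by simp [hA0]⟩
    · refine ⟨-φ B + r, 2 * φ A, .inr (by simp [hA0]), ?_⟩
      simp [map_ofNat] at hr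
      linear_combination φ A * hr
  rw [← key] at h0
  refine ⟨finrank ℚ L, ⟨L, _, _, inferInstance, rfl, _, planeVec_ne_zero hd hφβ hlm, ?_, h0⟩, ?_⟩
  · rw [Q0_planeVec hφβ hφ, h0, mul_zero]
  · rcases hL with hL | hL <;> norm_num [hL, h3]

theorem dvd_two_of_forall_dvd {d : ℤ} (hd : d ≡ 5 [ZMOD 12])
    (hloc : ∀ (p : ℕ) [Fact p.Prime], (p : ℤ) ∣ d →
      ∀ (L : Type) [Field L] [Algebra ℚ_[p] L] [FiniteDimensional ℚ_[p] L],
        ∀ θ : L, θ ^ 3 + 3 * θ ^ 2 + 3 * θ - 9 = 0 → Algebra.adjoin ℚ_[p] {θ} = ⊤ →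
          ∃ s : L, s ^ 2 = θ) {m : ℕ} (hm : ∀ n ∈ Degrees d, m ∣ n) : m ∣ 2 := by
  have hd0 : d ≠ 0 := by rintro rfl; exact absurd hd (by decide)
  obtain ⟨K, _, _, _, β, φ, t, h3, hβ, ht, hφ⟩ := exists_cubic_field
  have : CharZero K := algebraRat.charZero K
  obtain ⟨a, b, h⟩ := isNormValue_neg hβ ht φ hφ hd hloc
  obtain ⟨n₁, hn₁, hn₁4⟩ := exists_mem_degrees_dvd_four d
  obtain ⟨n₂, hn₂, hn₂6⟩ := exists_mem_degrees_dvd_six h3 hd0 hβ (by simpa using h)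
  exact Nat.dvd_gcd ((hm _ hn₁).trans hn₁4) ((hm _ hn₂).trans hn₂6)

end

section

open WithZero Module NumberField IsDedekindDomain

theorem three_adic_aux (a b c w : WithZero (Multiplicative ℤ)) {e : ℤ} (he : Odd e) (he0 : 0 < e)
    (h1 : w * w ≤ a * b) (h2 : exp (-e) * (c * c) ≤ a * b)
    (h3 : a * a ≤ exp (-e) * (w * max w c)) (h4 : b * b ≤ w * max w c) :
    a = 0 ∧ b = 0 ∧ c = 0 ∧ w = 0 := by
  obtain ⟨k, rfl⟩ := he
  obtain ⟨m, hm, hm'⟩ : ∃ m, m = max w c ∧ (m = w ∨ m = c ∧ w < c) := by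
    refine ⟨_, rfl, ?_⟩
    rcases lt_or_ge w c with h | h
    · exact .inr ⟨max_eq_right h.le, h⟩
    · exact .inl (max_eq_left h)
  rw [← hm] at h3 h4
  clear hm
  have hz : ∀ z : WithZero (Multiplicative ℤ), z = 0 ∨ ∃ x, z = exp x := fun z ↦
    or_iff_not_imp_left.2 fun hz ↦ ⟨log z, (exp_log hz).symm⟩
  rcases hz a with rfl | ⟨a, rfl⟩ <;> rcases hz b with rfl | ⟨b, rfl⟩ <;>
    rcases hz c with rfl | ⟨c, rfl⟩ <;> rcases hz w with rfl | ⟨w, rfl⟩ <;>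
    rcases hm' with rfl | ⟨rfl, h5⟩ <;>
    simp [← exp_add] at * <;> omega

theorem exists_heightOneSpectrum_three {F : Type*} [Field F] [NumberField F]
    (hF : Odd (finrank ℚ F)) : ∃ (v : HeightOneSpectrum (𝓞 F)) (e : ℤ), Odd e ∧ 0 < e ∧
      v.valuation F 3 = exp (-e) ∧ ¬ IsSquare (-1 : 𝓞 F ⧸ v.asIdeal) := by
  have hp : Prime (3 : ℤ) := Int.prime_three
  have : (Ideal.span {(3 : ℤ)}).IsPrime := (Ideal.span_singleton_prime hp.ne_zero).2 hp
  have h3 : Ideal.span {(3 : ℤ)} ≠ ⊥ := by simp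
  have : (Ideal.span {(3 : ℤ)}).IsMaximal := this.isMaximal h3
  have hfin : Finite ((Ideal.span {(3 : ℤ)}).primesOver (𝓞 F)) := inferInstance
  let := Fintype.ofFinite ((Ideal.span {(3 : ℤ)}).primesOver (𝓞 F))
  have hsum := Ideal.sum_ramification_inertia_eq_finrank (Ideal.span {(3 : ℤ)}) (𝓞 F)
  rw [RingOfIntegers.rank] at hsum
  rw [← hsum] at hF
  obtain ⟨⟨P, hP, hPl⟩, hodd⟩ : ∃ q : (Ideal.span {(3 : ℤ)}).primesOver (𝓞 F),
      Odd (q.1.ramificationIdx ℤ * q.1.inertiaDeg ℤ) := by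
    by_contra! h
    refine Nat.not_even_iff_odd.2 hF (Finset.even_sum _ fun q _ ↦ Nat.not_odd_iff_even.1 (h q))
  obtain ⟨he, hf⟩ := Nat.odd_mul.1 hodd
  have hmap : (Ideal.span {(3 : ℤ)}).map (algebraMap ℤ (𝓞 F)) = Ideal.span {3} := by
    simp [Ideal.map_span]
  have hmap0 : (Ideal.span {(3 : ℤ)}).map (algebraMap ℤ (𝓞 F)) ≠ ⊥ := by
    rw [hmap]; simp
  have hP0 : P ≠ ⊥ := ne_bot_of_le_ne_bot hmap0 (Ideal.map_le_of_le_comap (P.over_def _).le)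
  let v : HeightOneSpectrum (𝓞 F) := ⟨P, hP, hP0⟩
  refine ⟨v, P.ramificationIdx ℤ, by exact_mod_cast he, by exact_mod_cast he.pos, ?_, ?_⟩
  · have h3F : algebraMap (𝓞 F) F 3 = 3 := map_ofNat _ 3
    have : v.valuation F 3 = v.intValuation 3 := h3F ▸ v.valuation_of_algebraMap (K := F) 3
    rw [this, v.intValuation_eq_exp_neg_multiplicity (by norm_num),
      Ideal.IsDedekindDomain.ramificationIdx_eq_multiplicity (Ideal.span {(3 : ℤ)}) P hmap0, hmap]
  · have hmax : P.IsMaximal := hP.isMaximal hP0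
    let := Ideal.Quotient.field P
    have hcard := Ideal.pow_inertiaDeg 3 P
    have : Finite (𝓞 F ⧸ P) := Ideal.finiteQuotientOfFreeOfNeBot P hP0
    let := Fintype.ofFinite (𝓞 F ⧸ P)
    rw [FiniteField.isSquare_neg_one_iff (F := 𝓞 F ⧸ P), not_not, ← Nat.card_eq_fintype_card]
    change P.cardQuot % 4 = 3
    rw [← Ideal.absNorm_apply, ← hcard]
    obtain ⟨k, hk⟩ := hf
    rw [hk, pow_succ, pow_mul, Nat.mul_mod, Nat.pow_mod]
    norm_num

section

variable {F : Type*} [Field F] [NumberField F] (v : HeightOneSpectrum (𝓞 F))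

theorem valuation_intCast_eq_one {e : ℤ} (he : 0 < e) (h3 : v.valuation F 3 = exp (-e)) {n : ℤ}
    (hn : ¬ 3 ∣ n) : v.valuation F n = 1 := by
  have hle : ∀ m : ℤ, v.valuation F m ≤ 1 := fun m ↦ by
    simpa using v.valuation_le_one (K := F) (m : 𝓞 F)
  refine (hle n).antisymm ?_
  obtain ⟨a, b, hab⟩ := (Int.prime_three.coprime_iff_not_dvd.2 hn)
  by_contra! h
  have h3' : v.valuation F 3 < 1 := by rw [h3, ← exp_zero, exp_lt_exp]; omega
  have h1 : v.valuation F ((a : F) * 3 + b * n) < 1 := by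
    refine Valuation.map_add_lt _ ?_ ?_
    · rw [map_mul]
      exact mul_lt_one_of_nonneg_of_lt_one_right (hle a) zero_le h3'
    · rw [map_mul]
      exact mul_lt_one_of_nonneg_of_lt_one_right (hle b) zero_le h
  have : (a : F) * 3 + b * n = 1 := by exact_mod_cast hab
  rw [this, map_one] at h1
  exact h1.false

/-- The form `y² - 2z²` is anisotropic modulo `v`. -/
theorem valuation_sq_sub_two_mul_sq {e : ℤ} (he : 0 < e) (h3 : v.valuation F 3 = exp (-e))
    (hsq : ¬ IsSquare (-1 : 𝓞 F ⧸ v.asIdeal)) (y z : F) :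
    v.valuation F (y ^ 2 - 2 * z ^ 2) = max (v.valuation F y) (v.valuation F z) ^ 2 := by
  have h2 : v.valuation F 2 = 1 := by
    simpa using valuation_intCast_eq_one v he h3 (n := 2) (by norm_num)
  rcases lt_trichotomy (v.valuation F y) (v.valuation F z) with h | h | h
  · rw [max_eq_right h.le, Valuation.map_sub_eq_of_lt_right]
    · simp [h2]
    · simpa [h2] using pow_lt_pow_left₀ h zero_le two_ne_zero
  · rw [← h, max_self]
    by_cases hz : z = 0
    · simp [hz]
    refine le_antisymm ?_ ?_
    · refine (Valuation.map_sub _ _ _).trans ?_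
      simp [h2, h]
    by_contra! hlt
    obtain ⟨n, t, hnt⟩ := v.exists_primeCompl_mul_eq_of_integer (K := F) (y / z) (by
      rw [map_div₀, h]; exact div_self_le_one _)
    have ht : v.valuation F (algebraMap (𝓞 F) F t) = 1 :=
      v.valuation_eq_one_iff_notMem.2 t.2
    have hvz : v.valuation F z ≠ 0 := by simpa using hz
    have h1 : v.valuation F (algebraMap (𝓞 F) F (n ^ 2 - 2 * t ^ 2)) < 1 := by
      have : algebraMap (𝓞 F) F (n ^ 2 - 2 * t ^ 2) =
          (y ^ 2 - 2 * z ^ 2) * (algebraMap (𝓞 F) F t / z) ^ 2 := by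
        rw [map_sub, map_mul, map_pow, map_pow, map_ofNat, ← hnt]
        field_simp
      rw [this, map_mul, map_pow, map_div₀, ht, ← h]
      rw [h] at hlt ⊢
      calc _ < v.valuation F z ^ 2 * (1 / v.valuation F z) ^ 2 :=
            mul_lt_mul_of_pos_right hlt (by simpa [zero_lt_iff])
        _ = 1 := by field_simp
    have h3m : (3 : 𝓞 F) ∈ v.asIdeal := by
      have h3F : algebraMap (𝓞 F) F 3 = 3 := map_ofNat _ 3
      refine (v.valuation_lt_one_iff_mem (K := F) 3).1 ?_
      change v.valuation F (algebraMap (𝓞 F) F 3) < 1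
      rw [h3F, h3, ← exp_zero, exp_lt_exp]
      omega
    rw [v.valuation_lt_one_iff_mem] at h1
    have hmax := v.isPrime.isMaximal v.ne_bot
    let := Ideal.Quotient.field v.asIdeal
    set f := Ideal.Quotient.mk v.asIdeal
    have ht0 : f t ≠ 0 := fun h ↦ t.2 (Ideal.Quotient.eq_zero_iff_mem.1 h)
    have e1 : f n ^ 2 - 2 * f t ^ 2 = 0 := by
      simpa [map_ofNat] using Ideal.Quotient.eq_zero_iff_mem.2 h1
    have e2 : (3 : 𝓞 F ⧸ v.asIdeal) = 0 := by
      simpa [map_ofNat] using Ideal.Quotient.eq_zero_iff_mem.2 h3m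
    refine hsq ⟨f n / f t, ?_⟩
    field_simp
    linear_combination -(f t) ^ 2 * e2 - e1
  · rw [max_eq_left h.le, Valuation.map_sub_eq_of_lt_left]
    · simp
    · simpa [h2] using pow_lt_pow_left₀ h zero_le two_ne_zero

theorem valuation_add_of_odd {e : ℤ} (he : Odd e) {x y : F} {m n : WithZero (Multiplicative ℤ)}
    (hx : v.valuation F x = m ^ 2) (hy : v.valuation F y = exp (-e) * n ^ 2) :
    v.valuation F (x + y) = max (m ^ 2) (exp (-e) * n ^ 2) := by
  by_cases h : m ^ 2 = exp (-e) * n ^ 2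
  · have hn : n = 0 := by
      by_contra hn
      have hm : m ≠ 0 := by rintro rfl; simp [hn] at h
      rw [← exp_log hn, ← exp_log hm, pow_two, pow_two, ← exp_add, ← exp_add, ← exp_add,
        exp_inj] at h
      obtain ⟨k, rfl⟩ := he
      omega
    have hy0 : y = 0 := by simpa [hn] using hy
    simp [hy0, hx, hn]
  · rw [Valuation.map_add_of_distinct_val _ (by rwa [hx, hy]), hx, hy]

end

theorem eq_zero_of_odd_finrank {F : Type*} [Field F] [NumberField F] (hF : Odd (finrank ℚ F))
    {d : ℤ} (hd : ¬ 3 ∣ d) {u : Fin 5 → F} (h0 : Q0 d u = 0) (h1 : Qinf d u = 0) :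
    u = 0 := by
  obtain ⟨v, e, he, he0, h3, hsq⟩ := exists_heightOneSpectrum_three hF
  have hcast : ∀ n : ℤ, ¬ 3 ∣ n → v.valuation F n = 1 := fun n ↦
    valuation_intCast_eq_one v he0 h3
  have hvd := hcast d hd
  have hv2 : v.valuation F 2 = 1 := by simpa using hcast 2 (by norm_num)
  set w := max (v.valuation F (u 2 - u 4)) (v.valuation F (u 4)) with hw
  have h2w : v.valuation F (u 2) ≤ w := by
    have := (v.valuation F).map_add (u 2 - u 4) (u 4)
    rwa [sub_add_cancel] at this
  have hN := valuation_sq_sub_two_mul_sq v he0 h3 hsq (u 2 - u 4) (u 4)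
  have e1 := valuation_add_of_odd v he (x := (u 2 - u 4) ^ 2 - 2 * u 4 ^ 2) (y := -(3 * u 3 ^ 2)) hN
    (n := v.valuation F (u 3)) (by simp [h3])
  have e2 := valuation_add_of_odd v he (x := u 0 ^ 2) (y := -(3 * u 1 ^ 2)) (map_pow _ _ _)
    (n := v.valuation F (u 1)) (by simp [h3])
  have r1 : (u 2 - u 4) ^ 2 - 2 * u 4 ^ 2 + -(3 * u 3 ^ 2) = 2 * d * u 0 * u 1 := by
    rw [Qinf] at h1; linear_combination h1
  have r2 : d * (u 0 ^ 2 + -(3 * u 1 ^ 2)) = -(2 * 3 * (u 2 ^ 2 + u 3 * (u 2 - u 4))) := by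
    rw [Q0] at h0; linear_combination h0
  rw [r1] at e1
  have e3 := congrArg (v.valuation F) r2
  simp only [map_mul, Valuation.map_neg, hvd, hv2, one_mul, h3, e2] at e1 e3
  have hle : v.valuation F (u 2 ^ 2 + u 3 * (u 2 - u 4)) ≤ w * max w (v.valuation F (u 3)) := by
    refine (Valuation.map_add _ _ _).trans (max_le ?_ ?_)
    · rw [map_pow, sq]
      exact mul_le_mul' h2w (h2w.trans (le_max_left _ _))
    · rw [map_mul, mul_comm]
      exact mul_le_mul' (le_max_left _ _) (le_max_right _ _)
  have hq : 0 < (exp (-e) : WithZero (Multiplicative ℤ)) := exp_pos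
  obtain ⟨ha, hb, hc, hw0⟩ := three_adic_aux (v.valuation F (u 0)) (v.valuation F (u 1))
    (v.valuation F (u 3)) w he he0 (by rw [e1, ← sq]; exact le_max_left _ _)
    (by rw [e1, ← sq]; exact le_max_right _ _)
    (by
      rw [← sq]
      exact (le_max_left _ _).trans (e3.le.trans (mul_le_mul_right hle _)))
    (by
      rw [← sq]
      refine le_of_mul_le_mul_left ?_ hq
      exact (le_max_right _ _).trans (e3.le.trans (mul_le_mul_right hle _)))
  have hu4 : v.valuation F (u 4) = 0 := le_zero_iff.1 (hw0 ▸ le_max_right _ _)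
  have hu2 : v.valuation F (u 2) = 0 := le_zero_iff.1 (hw0 ▸ h2w)
  rw [map_eq_zero] at ha hb hc hu2 hu4
  ext i; fin_cases i <;> assumption

theorem two_dvd_of_mem_degrees {d : ℤ} (hd : d ≡ 5 [ZMOD 12]) {n : ℕ} (hn : n ∈ Degrees d) :
    2 ∣ n := by
  obtain ⟨F, _, iA, _, rfl, u, hu, h0, h1⟩ := hn
  have : CharZero F := algebraRat.charZero F
  obtain rfl : iA = DivisionRing.toRatAlgebra := Subsingleton.elim _ _
  have : NumberField F := ⟨⟩
  have hd' : d % 12 = 5 := hd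
  by_contra h
  exact hu (eq_zero_of_odd_finrank (Nat.not_even_iff_odd.1 fun h' ↦ h h'.two_dvd) (by omega) h0 h1)

end

/-- If `d ≡ 5 (mod 12)` and, for every prime `p ∣ d`, every root `θ` of `T³ + 3T² + 3T - 9`
lying in a finite extension `L/ℚ_p` that it generates is a square in `L`, then the quartic
del Pezzo surface `X_d` has index exactly 2: the gcd of the degrees of its closed points
equals 2 (every degree is even, and every common divisor of all the degrees divides 2). -/
theorem stmt14 (d : ℤ) (hd : d ≡ 5 [ZMOD 12])
    (hloc : ∀ (p : ℕ) [Fact p.Prime], (p : ℤ) ∣ d →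
      ∀ (L : Type) [Field L] [Algebra ℚ_[p] L] [FiniteDimensional ℚ_[p] L],
        ∀ θ : L, θ ^ 3 + 3 * θ ^ 2 + 3 * θ - 9 = 0 → Algebra.adjoin ℚ_[p] {θ} = ⊤ →
          ∃ s : L, s ^ 2 = θ) :
    (∀ n ∈ Degrees d, 2 ∣ n) ∧ (∀ m : ℕ, (∀ n ∈ Degrees d, m ∣ n) → m ∣ 2) := by
  exact ⟨fun _ ↦ two_dvd_of_mem_degrees hd, fun _ ↦ dvd_two_of_forall_dvd hd hloc⟩
end

section
/- For every finite field extension L of ℚ_7 and every element θ ∈ L satisfying θ^3 + 3θ^2 + 3θ - 9 = 0 and generating L over ℚ_7, the element θ is a square in L. (That is, a root ζ of T^3 + 3T^2 + 3T - 9 is a square in ℚ_7 ⊗ ℚ(ζ).) -/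
instance : Fact (Nat.Prime 7) := ⟨by norm_num⟩

/-- The quartic satisfied by the trace of a square root of a root of `T³ + 3T² + 3T - 9`
has a root in `ℤ₇`. -/
theorem exists_padicInt_root_quartic :
    ∃ a : ℤ_[7], a ^ 4 + 6 * a ^ 2 - 24 * a - 3 = 0 := by
  let F : Polynomial ℤ_[7] :=
    Polynomial.X ^ 4 + 6 * Polynomial.X ^ 2 - 24 * Polynomial.X - 3
  have hF (x : ℤ_[7]) : F.aeval x = x ^ 4 + 6 * x ^ 2 - 24 * x - 3 := by
    simp [F]
  have hF' (x : ℤ_[7]) : F.derivative.aeval x = 4 * x ^ 3 + 12 * x - 24 := by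
    simp [F]
    ring
  have hval : ‖F.aeval (-1 : ℤ_[7])‖ < 1 := by
    rw [hF, show (-1 : ℤ_[7]) ^ 4 + 6 * (-1) ^ 2 - 24 * (-1) - 3 = ((28 : ℤ) : ℤ_[7]) by
      norm_num, PadicInt.norm_int_lt_one_iff_dvd]
    norm_num
  have hder : ‖F.derivative.aeval (-1 : ℤ_[7])‖ = 1 := by
    rw [hF', show 4 * (-1 : ℤ_[7]) ^ 3 + 12 * (-1) - 24 = ((-40 : ℤ) : ℤ_[7]) by norm_num]
    refine le_antisymm (PadicInt.norm_le_one _) (not_lt.mp ?_)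
    rw [PadicInt.norm_int_lt_one_iff_dvd]
    norm_num
  obtain ⟨a, ha, -⟩ := hensels_lemma (F := F) (a := -1) (by rw [hder, one_pow]; exact hval)
  exact ⟨a, by rw [← hF, ha]⟩

/-- Over a field of characteristic zero, a root of `a⁴ + 6a² - 24a - 3` yields a square root of
any root of `T³ + 3T² + 3T - 9`. -/
theorem exists_sq_eq_of_quartic_root {L : Type*} [Field L] [CharZero L] {a θ : L}
    (ha : a ^ 4 + 6 * a ^ 2 - 24 * a - 3 = 0) (hθ : θ ^ 3 + 3 * θ ^ 2 + 3 * θ - 9 = 0) :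
    ∃ s : L, s ^ 2 = θ := by
  obtain ⟨b, hb⟩ : ∃ b : L, 2 * b = a ^ 2 + 3 := ⟨(a ^ 2 + 3) / 2, by field_simp⟩
  have hb2 : b ^ 2 = 6 * a + 3 := by
    refine mul_left_cancel₀ (by norm_num : (4 : L) ≠ 0) ?_
    linear_combination (2 * b + a ^ 2 + 3) * hb + ha
  have key : (a * θ + 3) ^ 2 = θ * (θ + b) ^ 2 := by
    linear_combination -hθ - θ ^ 2 * hb - θ * hb2
  have hne : θ + b ≠ 0 := by
    intro h
    have hnum : a * θ + 3 = 0 := by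
      rw [h] at key
      simpa using key
    have hab : a * b = 3 := by linear_combination a * h - hnum
    have hcub : a ^ 3 + 3 * a - 6 = 0 := by linear_combination 2 * hab - a * hb
    have hquad : a ^ 2 - 6 * a - 1 = 0 := by
      refine (mul_eq_zero.mp (?_ : 3 * (a ^ 2 - 6 * a - 1) = 0)).resolve_left three_ne_zero
      linear_combination ha - a * hcub
    have ha0 : a = 0 := by
      refine (mul_eq_zero.mp (?_ : 40 * a = 0)).resolve_left (by norm_num)
      linear_combination hcub - (a + 6) * hquad
    rw [ha0] at hquad
    norm_num at hquad
  refine ⟨(a * θ + 3) / (θ + b), ?_⟩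
  rw [div_pow, key]
  field_simp

/-- A root `ζ` of `T³ + 3T² + 3T - 9` is a square in `ℚ₇ ⊗ ℚ(ζ)`: in every finite field
extension `L` of `ℚ₇` generated by an element `θ` with `θ³ + 3θ² + 3θ - 9 = 0`, the element
`θ` is a square. -/
theorem stmt15 :
    ∀ (L : Type) [Field L] [Algebra ℚ_[7] L] [FiniteDimensional ℚ_[7] L],
      ∀ θ : L, θ ^ 3 + 3 * θ ^ 2 + 3 * θ - 9 = 0 → Algebra.adjoin ℚ_[7] {θ} = ⊤ →
        ∃ s : L, s ^ 2 = θ := by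
  intro L _ _ _ θ hθ _
  obtain ⟨a, ha⟩ := exists_padicInt_root_quartic
  have : CharZero L := charZero_of_injective_algebraMap (algebraMap ℚ_[7] L).injective
  let f : ℤ_[7] →+* L := (algebraMap ℚ_[7] L).comp PadicInt.Coe.ringHom
  refine exists_sq_eq_of_quartic_root (a := f a) ?_ hθ
  simpa only [map_sub, map_add, map_mul, map_pow, map_ofNat, map_zero] using congrArg f ha
end
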